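/- arXiv:math/0606338 — 2 statements merged into one kernel-verified Lean document; each statement's English description precedes it below -/
import Mathlib

section
/- Assume (H1). For every c > 0 there exists γ > 0 such that, for n large enough, P_n( there exist (k,j) ∈ I_K, a vertex u of T, and an integer l ∈ (0, |u|] with |A_{u,l,k,j} − μ_k l| ≥ γ √(l log n) ) ≤ n^{−c}. -/
open scoped Classical
open Filter
noncomputable section

/-- A planar tree: a finite set of words on `{1,2,...}` containing the root `[]`,
closed under taking fathers and elder brothers. -/
def IsPlanarTree (T : Finset (List ℕ)) : Prop :=
  [] ∈ T ∧ ∀ (u : List ℕ) (i : ℕ), u ++ [i] ∈ T →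
    1 ≤ i ∧ u ∈ T ∧ ∀ j, 1 ≤ j → j ≤ i → u ++ [j] ∈ T

/-- The type of planar trees. -/
def PlanarTree := {T : Finset (List ℕ) // IsPlanarTree T}

/-- Number of children of the vertex `u` in `T`. -/
def numChildren (T : Finset (List ℕ)) (u : List ℕ) : ℕ :=
  (T.filter fun v => ∃ i, v = u ++ [i]).card

/-- Galton-Watson weight of a tree: product over the vertices of `μ (number of children)`. -/
def gwWeight (μ : ℕ → ℝ) (T : Finset (List ℕ)) : ℝ :=
  ∏ u ∈ T, μ (numChildren T u)

/-- Probability of a set of planar trees under the Galton-Watson measure. -/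
def gwProb (μ : ℕ → ℝ) (S : Set PlanarTree) : ℝ :=
  ∑' T : S, gwWeight μ (T : PlanarTree).val

/-- `P(|T| = n)` : probability that the total progeny has `n` vertices. -/
def treeSizeProb (μ : ℕ → ℝ) (n : ℕ) : ℝ :=
  gwProb μ {T | T.val.card = n}

/-- Hypothesis (H1): `μ` is a probability distribution on ℕ, non-degenerate
(`μ 0 + μ 1 ≠ 1`), critical (mean 1), with support bounded by `K > 0`. -/
def H1 (μ : ℕ → ℝ) (K : ℕ) : Prop :=
  (∀ k, 0 ≤ μ k) ∧ HasSum μ 1 ∧ μ 0 + μ 1 ≠ 1 ∧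
    HasSum (fun k : ℕ => (k : ℝ) * μ k) 1 ∧ 0 < K ∧ ∀ k, K < k → μ k = 0

/-- Law of the random walk `W` started at 0 with i.i.d. increments distributed as
`ξ - 1`, `ξ ∼ μ` : `walkProb μ n x = P(W_n = x)`. -/
def walkProb (μ : ℕ → ℝ) : ℕ → ℤ → ℝ
  | 0, x => if x = 0 then 1 else 0
  | n + 1, x => ∑' k : ℕ, μ k * walkProb μ n (x - ((k : ℤ) - 1))

/-- `P_n(S) = P(S | |𝐓| = n+1)` : the Galton-Watson measure conditioned to have `n`
edges (`n+1` vertices). -/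
def condProb (μ : ℕ → ℝ) (n : ℕ) (S : Set PlanarTree) : ℝ :=
  gwProb μ (S ∩ {T | T.val.card = n + 1}) / treeSizeProb μ (n + 1)

/-- `u(k)`, the `(k+1)`-st vertex of `T` in the lexicographical (depth-first) order
(`[]`-junk value if `k` exceeds the number of vertices). -/
def vertexAt (T : PlanarTree) (k : ℕ) : List ℕ :=
  (T.val.sort (· ≤ ·)).getD k []

/-- The index set `I_K = {(k,j) : 1 ≤ j ≤ k ≤ K}` as a finset of `ℕ × ℕ`. -/
def IKfin (K : ℕ) : Finset (ℕ × ℕ) :=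
  (Finset.range (K + 1) ×ˢ Finset.range (K + 1)).filter fun p => 1 ≤ p.2 ∧ p.2 ≤ p.1

/-- The index set `I_K` as a (finite) type. -/
def IK (K : ℕ) := {p : ℕ × ℕ // p ∈ IKfin K}

instance (K : ℕ) : Fintype (IK K) := by unfold IK; infer_instance
instance (K : ℕ) : DecidableEq (IK K) := by unfold IK; infer_instance

/-- `A_{u,k,j}(T)`: the number of strict ancestors `v` of `u` having `k` children
and such that `u` is a descendant of `v·j`, the `j`-th child of `v`. -/
def Acount (T : PlanarTree) (u : List ℕ) (k j : ℕ) : ℕ :=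
  (T.val.filter fun v => (v ++ [j]) <+: u ∧ numChildren T.val v = k).card

/-- `A_{u,l,k,j}(T)`: the number of strict ancestors `v` of `u` at distance at most
`l` from `u`, having `k` children and such that `u` is a descendant of `v·j`. -/
def AcountLe (T : PlanarTree) (u : List ℕ) (l k j : ℕ) : ℕ :=
  (T.val.filter fun v =>
    (v ++ [j]) <+: u ∧ u.length - v.length ≤ l ∧ numChildren T.val v = k).card

/-- The tree whose root has the trees `f 0, …, f (k-1)` as successive subtrees. -/
def graft (k : ℕ) (f : Fin k → PlanarTree) : PlanarTree :=
  ⟨insert [] (Finset.univ.biUnion fun i : Fin k => (f i).val.image (List.cons (i.val + 1))), by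
    refine ⟨by simp, fun u i hu => ?_⟩
    rcases u with _ | ⟨a, u⟩
    · simp only [List.nil_append, Finset.mem_insert, Finset.mem_biUnion, Finset.mem_univ,
        Finset.mem_image, true_and, List.cons.injEq, reduceCtorEq, false_or] at hu ⊢
      obtain ⟨a, v, hv, rfl, rfl⟩ := hu
      refine ⟨by omega, by simp, fun j hj hj' => ?_⟩
      have ha := a.2
      exact ⟨⟨j - 1, by omega⟩, [], (f _).2.1, by simp; omega, rfl⟩
    · simp only [List.cons_append, Finset.mem_insert, Finset.mem_biUnion, Finset.mem_univ,
        Finset.mem_image, true_and, List.cons.injEq, reduceCtorEq, false_or] at hu ⊢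
      obtain ⟨a, v, hv, rfl, rfl⟩ := hu
      obtain ⟨h₁, h₂, h₃⟩ := (f a).2.2 u i hv
      exact ⟨h₁, ⟨a, u, h₂, rfl, rfl⟩, fun j hj hj' => ⟨a, _, h₃ j hj hj', rfl, rfl⟩⟩⟩

lemma nil_mem_graft (k : ℕ) (f : Fin k → PlanarTree) : [] ∈ (graft k f).val :=
  (graft k f).2.1

lemma cons_mem_graft {k : ℕ} {f : Fin k → PlanarTree} {a : ℕ} {u : List ℕ} :
    a :: u ∈ (graft k f).val ↔ ∃ i : Fin k, i.val + 1 = a ∧ u ∈ (f i).val := by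
  simp only [graft, Finset.mem_insert, reduceCtorEq, Finset.mem_biUnion, Finset.mem_univ,
    Finset.mem_image, true_and, List.cons.injEq, false_or]
  constructor
  · rintro ⟨i, v, hv, rfl, rfl⟩
    exact ⟨i, rfl, hv⟩
  · rintro ⟨i, rfl, hv⟩
    exact ⟨i, u, hv, rfl, rfl⟩

lemma succ_cons_mem_graft {k : ℕ} {f : Fin k → PlanarTree} {i : Fin k} {u : List ℕ} :
    (i.val + 1) :: u ∈ (graft k f).val ↔ u ∈ (f i).val := by
  rw [cons_mem_graft]
  constructor
  · rintro ⟨j, hj, h⟩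
    obtain rfl : j = i := Fin.ext (by omega)
    exact h
  · exact fun h => ⟨i, rfl, h⟩

@[to_additive]
lemma prod_graft {M : Type*} [CommMonoid M] (k : ℕ) (f : Fin k → PlanarTree) (h : List ℕ → M) :
    ∏ u ∈ (graft k f).val, h u = h [] * ∏ i, ∏ u ∈ (f i).val, h ((i.val + 1) :: u) := by
  rw [graft, Finset.prod_insert (by simp), Finset.prod_biUnion]
  · congr 1
    refine Finset.prod_congr rfl fun i _ => ?_
    rw [Finset.prod_image (fun a _ b _ hab => by simpa using hab)]
  · intro i _ j _ hij
    rw [Function.onFun, Finset.disjoint_left]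
    intro u hu hu'
    simp only [Finset.mem_image] at hu hu'
    obtain ⟨v, _, rfl⟩ := hu
    obtain ⟨w, _, hw⟩ := hu'
    simp only [List.cons.injEq, Nat.add_right_cancel_iff] at hw
    exact hij (Fin.ext hw.1.symm)

lemma graft_bijective :
    Function.Bijective fun x : Σ k, (Fin k → PlanarTree) => graft x.1 x.2 := by
  constructor
  · rintro ⟨k, f⟩ ⟨k', f'⟩ h
    have hk : ∀ a, a < k ↔ a < k' := by
      intro a
      have key : ∀ (k : ℕ) (f : Fin k → PlanarTree), a < k ↔ [a + 1] ∈ (graft k f).val := by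
        intro k f
        rw [cons_mem_graft]
        constructor
        · exact fun ha => ⟨⟨a, ha⟩, rfl, (f _).2.1⟩
        · rintro ⟨i, hi, _⟩
          have := i.2
          omega
      simp only at h
      rw [key k f, key k' f', h]
    obtain rfl : k = k' := by
      rcases lt_trichotomy k k' with h | h | h
      · exact absurd ((hk k).2 h) (lt_irrefl _)
      · exact h
      · exact absurd ((hk k').1 h) (lt_irrefl _)
    congr
    funext i
    apply Subtype.ext
    ext u
    simp only at h
    rw [← succ_cons_mem_graft, ← succ_cons_mem_graft (f := f'), h]
  · intro T
    have hinj : Function.Injective fun i : ℕ => [i + 1] := fun a b h => by simpa using h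
    obtain ⟨k, hk⟩ : ∃ k, [k + 1] ∉ T.val := by
      by_contra! hcon
      exact Set.infinite_of_injective_forall_mem (s := (T.val : Set (List ℕ))) hinj hcon
        T.val.finite_toSet
    have hex : ∃ k, [k + 1] ∉ T.val := ⟨k, hk⟩
    have hlt : ∀ a, a < Nat.find hex ↔ [a + 1] ∈ T.val := by
      intro a
      constructor
      · exact fun ha => not_not.1 (Nat.find_min hex ha)
      · intro ha
        by_contra! hle
        exact Nat.find_spec hex ((T.2.2 [] (a + 1) ha).2.2 _ (by omega) (by omega))
    have hpre : ∀ u a, a :: u ∈ T.val → [a] ∈ T.val := by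
      intro u
      induction u using List.reverseRecOn with
      | nil => exact fun a h => h
      | append_singleton u b ih =>
        intro a h
        exact ih a (T.2.2 (a :: u) b (by simpa using h)).2.1
    have hcons : ∀ a, Function.Injective (List.cons a : List ℕ → List ℕ) :=
      fun a => List.cons_injective
    refine ⟨⟨Nat.find hex, fun i => ⟨T.val.preimage (List.cons (i.val + 1)) (hcons _).injOn, ?_⟩⟩,
      ?_⟩
    · refine ⟨by simpa using (hlt i).1 i.2, fun u b hu => ?_⟩
      simp only [Finset.mem_preimage] at hu ⊢
      simpa using T.2.2 ((i.val + 1) :: u) b hu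
    · apply Subtype.ext
      ext u
      rcases u with _ | ⟨a, u⟩
      · exact ⟨fun _ => T.2.1, fun _ => nil_mem_graft _ _⟩
      · refine cons_mem_graft.trans ?_
        simp only [Finset.mem_preimage]
        constructor
        · rintro ⟨i, rfl, h⟩
          exact h
        · intro h
          have ha := hpre u a h
          have h1 := (T.2.2 [] a ha).1
          obtain ⟨b, rfl⟩ : ∃ b, a = b + 1 := ⟨a - 1, by omega⟩
          exact ⟨⟨b, (hlt b).2 ha⟩, rfl, h⟩

lemma numChildren_eq_sum (T : Finset (List ℕ)) (u : List ℕ) :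
    numChildren T u = ∑ v ∈ T, if ∃ i, v = u ++ [i] then 1 else 0 := by
  rw [numChildren, Finset.card_filter]

lemma numChildren_graft_nil (k : ℕ) (f : Fin k → PlanarTree) :
    numChildren (graft k f).val [] = k := by
  rw [numChildren_eq_sum, sum_graft]
  have : ∀ i : Fin k, ∑ u ∈ (f i).val,
      (if ∃ j, (i.val + 1) :: u = [] ++ [j] then 1 else 0) = 1 := by
    intro i
    rw [Finset.sum_eq_single_of_mem [] (f i).2.1]
    · simp
    · intro u _ hu
      simp [hu]
  simp only [this]
  simp

lemma numChildren_graft_cons (k : ℕ) (f : Fin k → PlanarTree) (i : Fin k) (u : List ℕ) :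
    numChildren (graft k f).val ((i.val + 1) :: u) = numChildren (f i).val u := by
  rw [numChildren_eq_sum, sum_graft, numChildren_eq_sum, Finset.sum_eq_single i]
  · simp
  · intro j _ hj
    have : (j : ℕ) ≠ i := fun h => hj (Fin.ext h)
    simp [this]
  · simp

lemma gwWeight_graft (μ : ℕ → ℝ) (k : ℕ) (f : Fin k → PlanarTree) :
    gwWeight μ (graft k f).val = μ k * ∏ i, gwWeight μ (f i).val := by
  simp only [gwWeight, prod_graft, numChildren_graft_nil, numChildren_graft_cons]

lemma card_graft (k : ℕ) (f : Fin k → PlanarTree) :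
    (graft k f).val.card = (∑ i, (f i).val.card) + 1 := by
  simp only [Finset.card_eq_sum_ones, sum_graft]
  ring

lemma card_pos (T : PlanarTree) : 0 < T.val.card := Finset.card_pos.2 ⟨[], T.2.1⟩

lemma AcountLe_eq_sum (T : PlanarTree) (u : List ℕ) (l k j : ℕ) :
    AcountLe T u l k j = ∑ v ∈ T.val,
      if (v ++ [j]) <+: u ∧ u.length - v.length ≤ l ∧ numChildren T.val v = k then 1 else 0 := by
  rw [AcountLe, Finset.card_filter]

lemma AcountLe_graft_cons (a : ℕ) (f : Fin a → PlanarTree) (i : Fin a) (u : List ℕ)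
    (l k j : ℕ) :
    AcountLe (graft a f) ((i.val + 1) :: u) l k j = AcountLe (f i) u l k j +
      if i.val + 1 = j ∧ u.length + 1 ≤ l ∧ a = k then 1 else 0 := by
  rw [AcountLe_eq_sum, sum_graft, AcountLe_eq_sum, Finset.sum_eq_single i, add_comm]
  · congr 1
    · refine Finset.sum_congr rfl fun v _ => ?_
      simp [numChildren_graft_cons]
    · simp [numChildren_graft_nil, eq_comm]
  · intro b _ hb
    have : (b : ℕ) ≠ i := fun h => hb (Fin.ext h)
    simp [this]
  · simp

lemma AcountLe_nil (T : PlanarTree) (l k j : ℕ) : AcountLe T [] l k j = 0 := by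
  simp [AcountLe]

lemma AcountLe_of_length_le (T : PlanarTree) {u : List ℕ} {l l' : ℕ} (k j : ℕ)
    (h : u.length ≤ l) (h' : u.length ≤ l') : AcountLe T u l k j = AcountLe T u l' k j := by
  unfold AcountLe
  congr 1
  refine Finset.filter_congr fun v _ => ?_
  have h₁ : u.length - v.length ≤ l := by omega
  have h₂ : u.length - v.length ≤ l' := by omega
  simp [h₁, h₂]

lemma take_mem (T : PlanarTree) {u : List ℕ} (hu : u ∈ T.val) (i : ℕ) : u.take i ∈ T.val := by
  induction u using List.reverseRecOn with
  | nil => simpa using hu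
  | append_singleton u b ih =>
    rcases le_or_gt i u.length with h | h
    · rw [List.take_append_of_le_length h]
      exact ih (T.2.2 u b hu).2.1
    · rwa [List.take_of_length_le (by simpa using h)]

lemma length_lt_card (T : PlanarTree) {u : List ℕ} (hu : u ∈ T.val) :
    u.length < T.val.card := by
  have : (Finset.range (u.length + 1)).card ≤ T.val.card := by
    refine Finset.card_le_card_of_injOn (fun i => u.take i) (fun i _ => take_mem T hu i) ?_
    intro i hi j hj hij
    have := congrArg List.length hij
    simp only [Finset.coe_range, Set.mem_Iio] at hi hj
    simp only [List.length_take] at this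
    omega
  simpa using this

open scoped ENNReal

/-- The Galton-Watson weight of a tree, as an extended nonnegative real. -/
def gwMass (μ : ℕ → ℝ) (T : PlanarTree) : ℝ≥0∞ := ENNReal.ofReal (gwWeight μ T.val)

lemma gwWeight_nonneg {μ : ℕ → ℝ} (h0 : ∀ k, 0 ≤ μ k) (T : Finset (List ℕ)) :
    0 ≤ gwWeight μ T := Finset.prod_nonneg fun _ _ => h0 _

lemma gwMass_graft {μ : ℕ → ℝ} (h0 : ∀ k, 0 ≤ μ k) (k : ℕ) (f : Fin k → PlanarTree) :
    gwMass μ (graft k f) = ENNReal.ofReal (μ k) * ∏ i, gwMass μ (f i) := by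
  simp only [gwMass, gwWeight_graft]
  rw [ENNReal.ofReal_mul (h0 k), ENNReal.ofReal_prod_of_nonneg fun i _ => gwWeight_nonneg h0 _]

lemma tsum_prod_apply {α : Type*} (m : ℕ) (g : Fin m → α → ℝ≥0∞) :
    ∑' f : Fin m → α, ∏ i, g i (f i) = ∏ i, ∑' a, g i a := by
  induction m with
  | zero => simp
  | succ m ih =>
    rw [← (Fin.consEquiv fun _ : Fin (m + 1) => α).tsum_eq, ENNReal.tsum_prod', Fin.prod_univ_succ,
      ← ih, ← ENNReal.tsum_mul_right]
    refine tsum_congr fun a => ?_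
    rw [← ENNReal.tsum_mul_left]
    refine tsum_congr fun f => ?_
    simp [Fin.consEquiv, Fin.prod_univ_succ]

lemma tsum_planarTree (g : PlanarTree → ℝ≥0∞) :
    ∑' T, g T = ∑' k, ∑' f : Fin k → PlanarTree, g (graft k f) := by
  rw [← (Equiv.ofBijective _ graft_bijective).tsum_eq g, ENNReal.tsum_sigma']
  rfl

lemma tsum_ofReal_eq_one {μ : ℕ → ℝ} (h0 : ∀ k, 0 ≤ μ k) (h1 : HasSum μ 1) :
    ∑' k, ENNReal.ofReal (μ k) = 1 := by
  rw [← ENNReal.ofReal_tsum_of_nonneg h0 h1.summable, h1.tsum_eq, ENNReal.ofReal_one]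

lemma tsum_gwMass_card_le {μ : ℕ → ℝ} (h0 : ∀ k, 0 ≤ μ k) (h1 : HasSum μ 1) (N : ℕ) :
    ∑' T, (if T.val.card ≤ N then gwMass μ T else 0) ≤ 1 := by
  induction N with
  | zero =>
    have : ∀ T : PlanarTree, (if T.val.card ≤ 0 then gwMass μ T else 0) = 0 := fun T =>
      if_neg (by have := card_pos T; omega)
    simp only [this]
    simp
  | succ N ih =>
    rw [tsum_planarTree, ← tsum_ofReal_eq_one h0 h1]
    refine ENNReal.tsum_le_tsum fun k => ?_
    calc ∑' f : Fin k → PlanarTree,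
          (if (graft k f).val.card ≤ N + 1 then gwMass μ (graft k f) else 0)
        ≤ ∑' f : Fin k → PlanarTree, ENNReal.ofReal (μ k) *
            ∏ i, (if (f i).val.card ≤ N then gwMass μ (f i) else 0) := by
          refine ENNReal.tsum_le_tsum fun f => ?_
          split_ifs with h
          · rw [gwMass_graft h0]
            refine le_of_eq ?_
            congr 1
            refine Finset.prod_congr rfl fun i _ => ?_
            rw [card_graft] at h
            rw [if_pos]
            have : (f i).val.card ≤ ∑ j, (f j).val.card :=
              Finset.single_le_sum (f := fun i => (f i).val.card) (fun _ _ => Nat.zero_le _)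
                (Finset.mem_univ i)
            omega
          · exact zero_le
      _ = ENNReal.ofReal (μ k) *
            ∏ _i : Fin k, ∑' T, (if T.val.card ≤ N then gwMass μ T else 0) := by
          rw [ENNReal.tsum_mul_left, tsum_prod_apply k fun _ (T : PlanarTree) =>
            (if T.val.card ≤ N then gwMass μ T else 0)]
      _ ≤ ENNReal.ofReal (μ k) := by
          refine mul_le_of_le_one_right' ?_
          rw [Finset.prod_const]
          exact pow_le_one₀ zero_le ih

lemma tsum_gwMass_le_one {μ : ℕ → ℝ} (h0 : ∀ k, 0 ≤ μ k) (h1 : HasSum μ 1) :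
    ∑' T, gwMass μ T ≤ 1 := by
  rw [ENNReal.tsum_eq_iSup_sum]
  refine iSup_le fun s => ?_
  calc ∑ T ∈ s, gwMass μ T
      = ∑ T ∈ s, (if T.val.card ≤ s.sup (fun T => T.val.card) then gwMass μ T else 0) := by
        refine Finset.sum_congr rfl fun T hT => ?_
        rw [if_pos (Finset.le_sup (f := fun T : PlanarTree => T.val.card) hT)]
    _ ≤ _ := ENNReal.sum_le_tsum s
    _ ≤ 1 := tsum_gwMass_card_le h0 h1 _

lemma tsum_prod_gwMass_mul_apply_le {μ : ℕ → ℝ} (h0 : ∀ k, 0 ≤ μ k) (h1 : HasSum μ 1)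
    (h : PlanarTree → ℝ≥0∞) (k : ℕ) (i : Fin k) :
    ∑' f : Fin k → PlanarTree, (∏ j, gwMass μ (f j)) * h (f i) ≤ ∑' T, gwMass μ T * h T := by
  calc ∑' f : Fin k → PlanarTree, (∏ j, gwMass μ (f j)) * h (f i)
      = ∑' f : Fin k → PlanarTree, ∏ j, (gwMass μ (f j) * if j = i then h (f j) else 1) := by
        refine tsum_congr fun f => ?_
        rw [Finset.prod_mul_distrib, Finset.prod_ite_eq' Finset.univ i, if_pos (Finset.mem_univ i)]
    _ = ∏ j, ∑' T, (gwMass μ T * if j = i then h T else 1) :=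
        tsum_prod_apply k fun j T => gwMass μ T * if j = i then h T else 1
    _ ≤ ∏ j, if j = i then ∑' T, gwMass μ T * h T else 1 := by
        refine Finset.prod_le_prod' fun j _ => ?_
        split_ifs
        · exact le_rfl
        · simpa using tsum_gwMass_le_one h0 h1
    _ = _ := by
        rw [Finset.prod_ite_eq' Finset.univ i, if_pos (Finset.mem_univ i)]

lemma tsum_gwMass_mul_le {μ : ℕ → ℝ} (h0 : ∀ k, 0 ≤ μ k) (h1 : HasSum μ 1)
    (g h : PlanarTree → ℝ≥0∞) (c : (k : ℕ) → Fin k → ℝ≥0∞)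
    (hg : ∀ k f, g (graft k f) = ∑ i, c k i * h (f i)) :
    ∑' T, gwMass μ T * g T ≤
      (∑' k, ENNReal.ofReal (μ k) * ∑ i, c k i) * ∑' T, gwMass μ T * h T := by
  rw [tsum_planarTree, ← ENNReal.tsum_mul_right]
  refine ENNReal.tsum_le_tsum fun k => ?_
  calc ∑' f : Fin k → PlanarTree, gwMass μ (graft k f) * g (graft k f)
      = ENNReal.ofReal (μ k) *
          ∑ i, c k i * ∑' f : Fin k → PlanarTree, (∏ j, gwMass μ (f j)) * h (f i) := by
        simp_rw [← ENNReal.tsum_mul_left]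
        rw [← Summable.tsum_finsetSum fun _ _ => ENNReal.summable, ← ENNReal.tsum_mul_left]
        refine tsum_congr fun f => ?_
        rw [gwMass_graft h0, hg, mul_assoc, Finset.mul_sum]
        congr 1
        refine Finset.sum_congr rfl fun i _ => ?_
        ring
    _ ≤ ENNReal.ofReal (μ k) * ∑ i, c k i * ∑' T, gwMass μ T * h T := by
        gcongr with i
        exact tsum_prod_gwMass_mul_apply_le h0 h1 h k i
    _ = _ := by rw [← Finset.sum_mul, mul_assoc]

/-- The exponential moment functional of the counts `A_{u,l,k,j}` over the vertices `u` of
depth `m`. -/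
def expSum (θ : ℝ) (k j m l : ℕ) (T : PlanarTree) : ℝ≥0∞ :=
  ∑ u ∈ T.val, if u.length = m then ENNReal.ofReal (Real.exp (θ * AcountLe T u l k j)) else 0

lemma expSum_graft_of_le (θ : ℝ) {k j m l : ℕ} (hl : l ≤ m) (a : ℕ) (f : Fin a → PlanarTree) :
    expSum θ k j (m + 1) l (graft a f) = ∑ i, 1 * expSum θ k j m l (f i) := by
  rw [expSum, sum_graft, if_neg (by simp), zero_add]
  refine Finset.sum_congr rfl fun i _ => ?_
  rw [expSum, one_mul]
  refine Finset.sum_congr rfl fun u _ => ?_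
  simp only [List.length_cons, Nat.add_right_cancel_iff]
  split_ifs with h
  · rw [AcountLe_graft_cons, if_neg (by omega), add_zero]
  · rfl

lemma expSum_graft_self (θ : ℝ) {k j m : ℕ} (a : ℕ) (f : Fin a → PlanarTree) :
    expSum θ k j (m + 1) (m + 1) (graft a f) =
      ∑ i : Fin a, ENNReal.ofReal (Real.exp (θ * if i.val + 1 = j ∧ a = k then 1 else 0)) *
        expSum θ k j m m (f i) := by
  rw [expSum, sum_graft, if_neg (by simp), zero_add]
  refine Finset.sum_congr rfl fun i _ => ?_
  rw [expSum, Finset.mul_sum]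
  refine Finset.sum_congr rfl fun u _ => ?_
  simp only [List.length_cons, Nat.add_right_cancel_iff]
  split_ifs with h h'
  all_goals
    first
    | simp; done
    | rw [AcountLe_graft_cons, AcountLe_of_length_le (f i) (l := m + 1) (l' := m) k j (by omega)
        (by omega), ← ENNReal.ofReal_mul (Real.exp_nonneg _), ← Real.exp_add]
      simp [h, h', mul_add, add_comm]

lemma sum_exp_fin (θ : ℝ) {k j : ℕ} (hj : 1 ≤ j) (hjk : j ≤ k) (a : ℕ) :
    ∑ i : Fin a, Real.exp (θ * if i.val + 1 = j ∧ a = k then 1 else 0) =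
      a + if a = k then Real.exp θ - 1 else 0 := by
  split_ifs with h
  · subst h
    have : ∀ i : Fin a, Real.exp (θ * if i.val + 1 = j ∧ a = a then 1 else 0) =
        1 + if i = ⟨j - 1, by omega⟩ then Real.exp θ - 1 else 0 := by
      intro i
      by_cases hi : i.val + 1 = j
      · rw [if_pos ⟨hi, rfl⟩, if_pos (Fin.ext (by simp; omega))]
        simp
      · rw [if_neg (fun h => hi h.1), if_neg (fun h => hi (by rw [h]; simp; omega))]
        simp
    rw [Finset.sum_congr rfl fun i _ => this i, Finset.sum_add_distrib]
    simp
  · simp [h]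

lemma tsum_gwMass_mul_expSum_le {μ : ℕ → ℝ} (h0 : ∀ k, 0 ≤ μ k) (h1 : HasSum μ 1)
    (hm : HasSum (fun k : ℕ => (k : ℝ) * μ k) 1) (θ : ℝ) {k j : ℕ} (hj : 1 ≤ j) (hjk : j ≤ k)
    (m l : ℕ) (hl : l ≤ m) :
    ∑' T, gwMass μ T * expSum θ k j m l T ≤
      ENNReal.ofReal (1 + μ k * (Real.exp θ - 1)) ^ l := by
  induction m generalizing l with
  | zero =>
    obtain rfl : l = 0 := by omega
    have : ∀ T, expSum θ k j 0 0 T = 1 := by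
      intro T
      rw [expSum, Finset.sum_eq_single_of_mem [] T.2.1]
      · simp [AcountLe_nil]
      · intro u _ hu
        simp [hu]
    simpa [this] using tsum_gwMass_le_one h0 h1
  | succ m ih =>
    rcases Nat.lt_or_ge m l with h | h
    · obtain rfl : l = m + 1 := by omega
      refine (tsum_gwMass_mul_le h0 h1 _ _ _ (expSum_graft_self θ)).trans ?_
      rw [pow_succ']
      refine mul_le_mul' (le_of_eq ?_) (ih m le_rfl)
      have hc : ∀ a : ℕ, ENNReal.ofReal (μ a) * ∑ i : Fin a, ENNReal.ofReal
          (Real.exp (θ * if i.val + 1 = j ∧ a = k then 1 else 0)) = ENNReal.ofReal (μ a *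
            ∑ i : Fin a, Real.exp (θ * if i.val + 1 = j ∧ a = k then 1 else 0)) := by
        intro a
        rw [ENNReal.ofReal_mul (h0 a)]
        congr 1
        exact (ENNReal.ofReal_sum_of_nonneg fun _ _ => Real.exp_nonneg _).symm
      rw [tsum_congr hc]
      have hs : HasSum (fun a => μ a * ∑ i : Fin a,
          Real.exp (θ * if i.val + 1 = j ∧ a = k then 1 else 0))
          (1 + μ k * (Real.exp θ - 1)) := by
        have := hm.add (hasSum_ite_eq k (μ k * (Real.exp θ - 1)))
        refine this.congr_fun ?_
        intro a
        rw [sum_exp_fin θ hj hjk]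
        split_ifs with h
        · rw [h]; ring
        · ring
      rw [← ENNReal.ofReal_tsum_of_nonneg _ hs.summable, hs.tsum_eq]
      exact fun a => mul_nonneg (h0 a) (Finset.sum_nonneg fun _ _ => Real.exp_nonneg _)
    · refine (tsum_gwMass_mul_le h0 h1 _ _ _ (expSum_graft_of_le θ h)).trans ?_
      refine (mul_le_of_le_one_left' (le_of_eq ?_)).trans (ih l h)
      have : ∀ a : ℕ, ENNReal.ofReal (μ a) * ∑ _i : Fin a, (1 : ℝ≥0∞) =
          ENNReal.ofReal (a * μ a) := by
        intro a
        rw [ENNReal.ofReal_mul (Nat.cast_nonneg a)]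
        simp [mul_comm]
      simp_rw [this]
      rw [← ENNReal.ofReal_tsum_of_nonneg (fun a => mul_nonneg (Nat.cast_nonneg a) (h0 a))
        hm.summable, hm.tsum_eq, ENNReal.ofReal_one]

lemma one_add_mul_exp_sub_one_le {p : ℝ} (hp0 : 0 ≤ p) (hp1 : p ≤ 1) (θ : ℝ) :
    1 + p * (Real.exp θ - 1) ≤ Real.exp (p * θ + θ ^ 2) := by
  rcases le_or_gt |θ| 1 with h | h
  · have h2 := Real.abs_exp_sub_one_sub_id_le h
    have h3 := (abs_le.1 h2).2
    calc 1 + p * (Real.exp θ - 1) ≤ 1 + (p * θ + θ ^ 2) := by nlinarith [sq_nonneg θ]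
      _ ≤ _ := by linarith [Real.add_one_le_exp (p * θ + θ ^ 2)]
  · rcases lt_abs.1 h with h | h
    · calc 1 + p * (Real.exp θ - 1) ≤ Real.exp θ := by
            nlinarith [Real.add_one_le_exp θ]
        _ ≤ _ := Real.exp_le_exp.2 (by nlinarith)
    · calc 1 + p * (Real.exp θ - 1) ≤ 1 := by
            have : Real.exp θ ≤ 1 := Real.exp_le_one_iff.2 (by linarith)
            nlinarith
        _ ≤ _ := Real.one_le_exp (by nlinarith)

/-- Total Galton-Watson mass of the ordered forests of `m` trees with `n` vertices in total. -/
def forestMass (μ : ℕ → ℝ) (m n : ℕ) : ℝ≥0∞ :=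
  ∑' f : Fin m → PlanarTree, if ∑ i, (f i).val.card = n then ∏ i, gwMass μ (f i) else 0

lemma forestMass_le_one {μ : ℕ → ℝ} (h0 : ∀ k, 0 ≤ μ k) (h1 : HasSum μ 1) (m n : ℕ) :
    forestMass μ m n ≤ 1 := by
  calc forestMass μ m n ≤ ∑' f : Fin m → PlanarTree, ∏ i, gwMass μ (f i) := by
        refine ENNReal.tsum_le_tsum fun f => ?_
        split_ifs
        · exact le_rfl
        · exact zero_le
    _ = ∏ _i : Fin m, ∑' T, gwMass μ T := tsum_prod_apply m fun _ T => gwMass μ T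
    _ ≤ 1 := Finset.prod_le_one' fun _ _ => tsum_gwMass_le_one h0 h1

lemma forestMass_zero (μ : ℕ → ℝ) (n : ℕ) : forestMass μ 0 n = if n = 0 then 1 else 0 := by
  simp [forestMass, eq_comm]

lemma forestMass_eq_zero_of_lt (μ : ℕ → ℝ) {m n : ℕ} (h : n < m) : forestMass μ m n = 0 := by
  rw [forestMass, ENNReal.tsum_eq_zero]
  intro f
  refine if_neg fun hf => ?_
  have : ∑ _i : Fin m, 1 ≤ ∑ i, (f i).val.card := Finset.sum_le_sum fun i _ => card_pos (f i)
  simp only [Finset.sum_const, Finset.card_univ, Fintype.card_fin, smul_eq_mul, mul_one] at this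
  omega

lemma forestMass_one (μ : ℕ → ℝ) (n : ℕ) :
    forestMass μ 1 n = ∑' T : PlanarTree, if T.val.card = n then gwMass μ T else 0 := by
  rw [forestMass, ← (Equiv.funUnique (Fin 1) PlanarTree).symm.tsum_eq]
  refine tsum_congr fun T => ?_
  simp [Equiv.funUnique]

lemma forestMass_add (μ : ℕ → ℝ) (k m n : ℕ) :
    forestMass μ (k + m) n = ∑' g : Fin k → PlanarTree, ∑' f : Fin m → PlanarTree,
      if (∑ i, (g i).val.card) + ∑ i, (f i).val.card = n then
        (∏ i, gwMass μ (g i)) * ∏ i, gwMass μ (f i) else 0 := by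
  rw [forestMass, ← (Fin.appendEquiv k m).tsum_eq, ENNReal.tsum_prod']
  refine tsum_congr fun g => tsum_congr fun f => ?_
  rw [Fin.sum_univ_add, Fin.prod_univ_add]
  simp [Fin.appendEquiv]

lemma forestMass_succ {μ : ℕ → ℝ} (h0 : ∀ k, 0 ≤ μ k) (m n : ℕ) :
    forestMass μ (m + 1) (n + 1) = ∑' k, ENNReal.ofReal (μ k) * forestMass μ (k + m) n := by
  rw [forestMass, ← (Fin.consEquiv fun _ : Fin (m + 1) => PlanarTree).tsum_eq,
    ENNReal.tsum_prod', tsum_planarTree]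
  refine tsum_congr fun k => ?_
  rw [forestMass_add, ← ENNReal.tsum_mul_left]
  refine tsum_congr fun g => ?_
  rw [← ENNReal.tsum_mul_left]
  refine tsum_congr fun f => ?_
  rw [Fin.sum_univ_succ, Fin.prod_univ_succ]
  simp only [Fin.consEquiv, Equiv.coe_fn_mk, Fin.cons_zero, Fin.cons_succ, card_graft,
    gwMass_graft h0, mul_ite, mul_zero, mul_assoc]
  refine if_congr ?_ rfl rfl
  omega

lemma toReal_forestMass_succ {μ : ℕ → ℝ} (h0 : ∀ k, 0 ≤ μ k) (h1 : HasSum μ 1) (m x : ℕ) :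
    (forestMass μ (m + 1) (m + x + 1)).toReal =
      ∑ p ∈ Finset.HasAntidiagonal.antidiagonal x, μ p.1 * (forestMass μ (p.1 + m) (m + x)).toReal := by
  have hne : ∀ m n, forestMass μ m n ≠ ∞ := fun m n =>
    ne_top_of_le_ne_top ENNReal.one_ne_top (forestMass_le_one h0 h1 m n)
  rw [forestMass_succ h0,
    ENNReal.tsum_toReal_eq fun k => ENNReal.mul_ne_top ENNReal.ofReal_ne_top (hne _ _),
    Finset.Nat.sum_antidiagonal_eq_sum_range_succ
      fun a _ => μ a * (forestMass μ (a + m) (m + x)).toReal, tsum_eq_sum]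
  · refine Finset.sum_congr rfl fun k _ => ?_
    rw [ENNReal.toReal_mul, ENNReal.toReal_ofReal (h0 k)]
  · intro k hk
    have : x < k := by simpa using hk
    rw [forestMass_eq_zero_of_lt μ (by omega)]
    simp

open PowerSeries in
lemma mul_coeff_pow_succ {R : Type*} [CommSemiring R] (φ : R⟦X⟧) (n x : ℕ) :
    x * coeff x (φ ^ (n + 1)) = (n + 1) *
      ∑ p ∈ Finset.HasAntidiagonal.antidiagonal x, p.1 * coeff p.1 φ * coeff p.2 (φ ^ n) := by
  cases x with
  | zero => simp
  | succ y =>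
    have h := congrArg (coeff y) (Derivation.leibniz_pow (PowerSeries.derivative R) φ (n + 1))
    rw [coeff_derivative, map_nsmul, nsmul_eq_mul, Nat.add_sub_cancel, smul_eq_mul] at h
    rw [Finset.Nat.sum_antidiagonal_succ]
    push_cast at h ⊢
    rw [mul_comm, h, mul_comm (φ ^ n), coeff_mul]
    simp only [coeff_derivative, zero_mul, zero_add]
    congr 1
    refine Finset.sum_congr rfl fun p _ => ?_
    ring

/-- The Otter–Dwass formula. -/
lemma mul_toReal_forestMass {μ : ℕ → ℝ} (h0 : ∀ k, 0 ≤ μ k) (h1 : HasSum μ 1) (n m x : ℕ)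
    (hn : n = m + x) :
    n * (forestMass μ m n).toReal = m * PowerSeries.coeff x (PowerSeries.mk μ ^ n) := by
  induction n generalizing m x with
  | zero =>
    obtain rfl : m = 0 := by omega
    simp
  | succ n ih =>
    rcases m with _ | m
    · simp [forestMass_zero]
    obtain rfl : n = m + x := by omega
    rw [toReal_forestMass_succ h0 h1]
    rcases Nat.eq_zero_or_pos (m + x) with h | h
    · obtain ⟨rfl, rfl⟩ : m = 0 ∧ x = 0 := by omega
      simp [forestMass_zero]
    · have hpos : (0 : ℝ) < (m + x : ℕ) := by exact_mod_cast h
      refine mul_left_cancel₀ hpos.ne' ?_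
      have hsum : ((m + x : ℕ) : ℝ) *
          ∑ p ∈ Finset.HasAntidiagonal.antidiagonal x, μ p.1 * (forestMass μ (p.1 + m) (m + x)).toReal =
          (∑ p ∈ Finset.HasAntidiagonal.antidiagonal x, (p.1 : ℝ) * PowerSeries.coeff p.1 (PowerSeries.mk μ) *
            PowerSeries.coeff p.2 (PowerSeries.mk μ ^ (m + x))) +
          m * PowerSeries.coeff x (PowerSeries.mk μ ^ (m + x + 1)) := by
        rw [pow_succ', PowerSeries.coeff_mul, Finset.mul_sum, Finset.mul_sum,
          ← Finset.sum_add_distrib]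
        refine Finset.sum_congr rfl fun p hp => ?_
        have hp' := Finset.HasAntidiagonal.mem_antidiagonal.1 hp
        have := ih (p.1 + m) p.2 (by omega)
        rw [PowerSeries.coeff_mk]
        push_cast at this ⊢
        linear_combination μ p.1 * this
      have hder := mul_coeff_pow_succ (PowerSeries.mk μ) (m + x) x
      push_cast at hsum hder ⊢
      linear_combination ((m : ℝ) + x + 1) * hsum - hder

lemma toReal_tsum_eq_gwProb {μ : ℕ → ℝ} (h0 : ∀ k, 0 ≤ μ k) (S : Set PlanarTree) :
    gwProb μ S = (∑' T, if T ∈ S then gwMass μ T else 0).toReal := by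
  have : ∀ T, (if T ∈ S then gwMass μ T else 0) = S.indicator (gwMass μ) T := fun T => rfl
  simp_rw [this]
  rw [← tsum_subtype, ENNReal.tsum_toReal_eq fun T => by exact ENNReal.ofReal_ne_top, gwProb]
  refine tsum_congr fun T => ?_
  rw [gwMass, ENNReal.toReal_ofReal (gwWeight_nonneg h0 _)]

lemma mul_treeSizeProb {μ : ℕ → ℝ} (h0 : ∀ k, 0 ≤ μ k) (h1 : HasSum μ 1) (n : ℕ) :
    ((n : ℝ) + 1) * treeSizeProb μ (n + 1) =
      PowerSeries.coeff n (PowerSeries.mk μ ^ (n + 1)) := by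
  have := mul_toReal_forestMass h0 h1 (n + 1) 1 n (by omega)
  rw [forestMass_one] at this
  rw [treeSizeProb, toReal_tsum_eq_gwProb h0]
  push_cast at this
  rw [one_mul] at this
  convert this
  exact Iff.rfl

open Nat in
lemma factorial_mul_pow_le_factorial_mul_pow_self (v m : ℕ) : v ! * v ^ m ≤ m ! * v ^ v := by
  rcases le_total v m with h | h
  · obtain ⟨d, rfl⟩ := Nat.exists_eq_add_of_le h
    calc v ! * v ^ (v + d) ≤ v ! * (v + 1) ^ d * v ^ v := by
          rw [pow_add, mul_comm (v ^ v), ← mul_assoc]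
          gcongr
          omega
      _ ≤ _ := Nat.mul_le_mul_right _ Nat.factorial_mul_pow_le_factorial
  · calc v ! * v ^ m = m ! * v.descFactorial (v - m) * v ^ m := by
          rw [← Nat.factorial_mul_descFactorial (Nat.sub_le v m), Nat.sub_sub_self h]
      _ ≤ m ! * v ^ (v - m) * v ^ m := by
          gcongr
          exact Nat.descFactorial_le_pow v (v - m)
      _ = _ := by rw [mul_assoc, ← pow_add, Nat.sub_add_cancel h]

lemma exp_neg_le_zpow {r δ N : ℝ} (hδ : δ ≤ 1 / 2) (hr : |r - 1| ≤ δ) (z : ℤ)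
    (hz : |(z : ℝ)| ≤ N) : Real.exp (-(2 * δ * N)) ≤ r ^ z := by
  have hr' := abs_le.1 hr
  have hr0 : 0 < r := by linarith
  have hδ0 : 0 ≤ δ := (abs_nonneg _).trans hr
  have hlog : |Real.log r| ≤ 2 * δ := by
    rw [abs_le]
    constructor
    · refine le_trans ?_ (Real.one_sub_inv_le_log_of_pos hr0)
      have : r⁻¹ ≤ 1 + 2 * δ := by
        rw [inv_le_iff_one_le_mul₀ hr0]
        nlinarith
      linarith
    · linarith [Real.log_le_sub_one_of_pos hr0]
  rw [← Real.rpow_intCast, Real.rpow_def_of_pos hr0]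
  refine Real.exp_le_exp.2 ?_
  have : |Real.log r * z| ≤ 2 * δ * N := by
    rw [abs_mul]
    exact mul_le_mul hlog hz (abs_nonneg _) (by linarith)
  linarith [(abs_le.1 this).1]

/-- The probability that a multinomial vector with parameters `∑ v` and `μ` equals `v`. -/
def multinomialWeight (μ : ℕ → ℝ) (s : Finset ℕ) (v : ℕ → ℕ) : ℝ :=
  (Nat.multinomial s v : ℝ) * ∏ k ∈ s, μ k ^ v k

lemma multinomialWeight_nonneg {μ : ℕ → ℝ} (h0 : ∀ k, 0 ≤ μ k) (s : Finset ℕ) (v : ℕ → ℕ) :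
    0 ≤ multinomialWeight μ s v :=
  mul_nonneg (Nat.cast_nonneg _) (Finset.prod_nonneg fun k _ => pow_nonneg (h0 k) _)

open Nat in
lemma multinomialWeight_eq (μ : ℕ → ℝ) (s : Finset ℕ) (v : ℕ → ℕ) :
    multinomialWeight μ s v = ((∑ k ∈ s, v k)! : ℝ) * ∏ k ∈ s, μ k ^ v k / (v k)! := by
  have h : ((∏ k ∈ s, (v k)! : ℕ) : ℝ) * Nat.multinomial s v = ((∑ k ∈ s, v k)! : ℝ) := by
    exact_mod_cast Nat.multinomial_spec s v
  have hne : ∏ k ∈ s, ((v k)! : ℝ) ≠ 0 :=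
    Finset.prod_ne_zero_iff.2 fun k _ => by exact_mod_cast Nat.factorial_ne_zero _
  rw [multinomialWeight, ← h, Finset.prod_div_distrib]
  push_cast
  field_simp

lemma multinomialWeight_mul_prod_le {μ : ℕ → ℝ} {s : Finset ℕ} (hpos : ∀ k ∈ s, 0 < μ k)
    {N : ℕ} (hN : 0 < N) {v m : ℕ → ℕ} (hv : ∑ k ∈ s, v k = N) (hm : ∑ k ∈ s, m k = N)
    (hv0 : ∀ k ∈ s, 0 < v k) :
    multinomialWeight μ s m * ∏ k ∈ s, ((v k : ℝ) / (μ k * N)) ^ ((m k : ℤ) - v k) ≤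
      multinomialWeight μ s v := by
  have hN' : (0 : ℝ) < N := by exact_mod_cast hN
  have hprod : ∏ k ∈ s, ((v k : ℝ) / (μ k * N)) ^ ((m k : ℤ) - v k) =
      ∏ k ∈ s, ((v k : ℝ) / μ k) ^ ((m k : ℤ) - v k) := by
    have : ∏ k ∈ s, (N : ℝ) ^ ((m k : ℤ) - v k) = 1 := by
      simp_rw [zpow_sub₀ hN'.ne', zpow_natCast]
      rw [Finset.prod_div_distrib, Finset.prod_pow_eq_pow_sum, Finset.prod_pow_eq_pow_sum, hv, hm,
        div_self (pow_ne_zero _ hN'.ne')]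
    simp_rw [← div_div, div_zpow _ (N : ℝ)]
    rw [Finset.prod_div_distrib, this, div_one]
  rw [hprod, multinomialWeight_eq, multinomialWeight_eq, hv, hm, mul_assoc,
    ← Finset.prod_mul_distrib]
  refine mul_le_mul_of_nonneg_left (Finset.prod_le_prod ?_ ?_) (Nat.cast_nonneg _)
  · intro k hk
    have := hpos k hk
    positivity
  · intro k hk
    have hμ := hpos k hk
    have hvk : (0 : ℝ) < v k := by exact_mod_cast hv0 k hk
    have hfac : ((v k).factorial : ℝ) * (v k : ℝ) ^ m k ≤ (m k).factorial * (v k : ℝ) ^ v k := by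
      exact_mod_cast factorial_mul_pow_le_factorial_mul_pow_self (v k) (m k)
    have h₁ : (0 : ℝ) < (v k).factorial := by exact_mod_cast Nat.factorial_pos _
    have h₂ : (0 : ℝ) < (m k).factorial := by exact_mod_cast Nat.factorial_pos _
    rw [zpow_sub₀ (div_pos hvk hμ).ne', zpow_natCast, zpow_natCast, div_pow, div_pow]
    have : μ k ^ m k / (m k).factorial *
        ((v k : ℝ) ^ m k / μ k ^ m k / ((v k : ℝ) ^ v k / μ k ^ v k)) =
        μ k ^ v k * ((v k : ℝ) ^ m k / ((m k).factorial * (v k : ℝ) ^ v k)) := by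
      field_simp
    rw [this, div_eq_mul_inv (μ k ^ v k)]
    gcongr
    rw [div_le_iff₀ (by positivity), inv_mul_eq_div, le_div_iff₀ h₁]
    linarith

lemma multinomialWeight_mul_exp_le {μ : ℕ → ℝ} {s : Finset ℕ} (h0 : ∀ k, 0 ≤ μ k)
    (hpos : ∀ k ∈ s, 0 < μ k)
    {N : ℕ} (hN : 0 < N) {v m : ℕ → ℕ} (hv : ∑ k ∈ s, v k = N) (hm : ∑ k ∈ s, m k = N) {C : ℝ}
    (hC : 0 < C) (hNC : ∀ k ∈ s, 2 * C ≤ N * μ k) (hvC : ∀ k ∈ s, |(v k : ℝ) - N * μ k| ≤ C) :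
    multinomialWeight μ s m * Real.exp (-∑ k ∈ s, 2 * C / μ k) ≤ multinomialWeight μ s v := by
  have hN' : (0 : ℝ) < N := by exact_mod_cast hN
  refine le_trans ?_ (multinomialWeight_mul_prod_le hpos hN hv hm ?_)
  · refine mul_le_mul_of_nonneg_left ?_ (multinomialWeight_nonneg h0 s m)
    rw [← Finset.sum_neg_distrib, Real.exp_sum]
    refine Finset.prod_le_prod (fun _ _ => Real.exp_nonneg _) fun k hk => ?_
    have hμ := hpos k hk
    have hle : ∀ w : ℕ → ℕ, ∑ k ∈ s, w k = N → (w k : ℝ) ≤ N := by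
      intro w hw
      rw [← hw]
      exact_mod_cast Finset.single_le_sum (f := w) (fun _ _ => Nat.zero_le _) hk
    have := exp_neg_le_zpow (r := (v k : ℝ) / (μ k * N)) (δ := C / (μ k * N)) (N := N)
      (by rw [div_le_iff₀ (by positivity)]; linarith [hNC k hk])
      (by
        have : (v k : ℝ) / (μ k * N) - 1 = (v k - N * μ k) / (μ k * N) := by
          field_simp
        rw [this, abs_div, abs_of_pos (a := μ k * N) (by positivity)]
        exact div_le_div_of_nonneg_right (hvC k hk) (by positivity))
      ((m k : ℤ) - v k)
      (by
        push_cast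
        rw [abs_le]
        have := hle v hv
        have := hle m hm
        have : (0 : ℝ) ≤ v k := Nat.cast_nonneg _
        have : (0 : ℝ) ≤ m k := Nat.cast_nonneg _
        constructor <;> linarith)
    refine le_trans (le_of_eq ?_) this
    congr 2
    field_simp
  · intro k hk
    have h₁ := abs_le.1 (hvC k hk)
    have h₂ := hNC k hk
    have : (0 : ℝ) < v k := by linarith
    exact_mod_cast this

lemma card_piAntidiag_le (s : Finset ℕ) (N : ℕ) :
    (s.piAntidiag N).card ≤ (N + 1) ^ s.card := by
  have h : (s.pi fun _ => Finset.range (N + 1)).card = (N + 1) ^ s.card := by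
    rw [Finset.card_pi]
    simp
  rw [← h]
  refine Finset.card_le_card_of_injOn (fun v k _ => v k) ?_ ?_
  · intro v hv
    simp only [Finset.mem_coe, Finset.mem_piAntidiag, Finset.mem_pi,
      Finset.mem_range] at hv ⊢
    intro k hk
    have := Finset.single_le_sum (f := v) (fun _ _ => Nat.zero_le _) hk
    rw [hv.1] at this
    omega
  · intro v hv w hw hvw
    funext k
    by_cases hk : k ∈ s
    · exact congrFun (congrFun hvw k) hk
    · rw [Finset.mem_coe, Finset.mem_piAntidiag] at hv hw
      rw [not_not.1 (mt (hv.2 k) hk), not_not.1 (mt (hw.2 k) hk)]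

open PowerSeries in
lemma mk_eq_sum (μ : ℕ → ℝ) (s : Finset ℕ) (hs : ∀ k, k ∉ s → μ k = 0) :
    (PowerSeries.mk μ) = ∑ k ∈ s, monomial k (μ k) := by
  ext n
  rw [coeff_mk, map_sum]
  simp_rw [coeff_monomial]
  rw [Finset.sum_ite_eq s n]
  split_ifs with h
  · rfl
  · exact hs n h

open PowerSeries in
lemma coeff_mk_pow (μ : ℕ → ℝ) (s : Finset ℕ) (hs : ∀ k, k ∉ s → μ k = 0) (N x : ℕ) :
    coeff x (PowerSeries.mk μ ^ N) =
      ∑ v ∈ s.piAntidiag N, if ∑ k ∈ s, k * v k = x then multinomialWeight μ s v else 0 := by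
  rw [mk_eq_sum μ s hs, Finset.sum_pow_eq_sum_piAntidiag, map_sum]
  refine Finset.sum_congr rfl fun v _ => ?_
  have : ∏ k ∈ s, (monomial k (μ k) : ℝ⟦X⟧) ^ v k =
      monomial (∑ k ∈ s, k * v k) (∏ k ∈ s, μ k ^ v k) := by
    simp_rw [monomial_pow]
    rw [prod_monomial]
    simp_rw [mul_comm]
  rw [this, ← nsmul_eq_mul, map_nsmul, coeff_monomial, nsmul_eq_mul, multinomialWeight, mul_ite,
    mul_zero]
  simp only [eq_comm]

lemma sum_multinomialWeight {μ : ℕ → ℝ} {s : Finset ℕ} (h1 : ∑ k ∈ s, μ k = 1) (N : ℕ) :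
    ∑ v ∈ s.piAntidiag N, multinomialWeight μ s v = 1 := by
  have := Finset.sum_pow_eq_sum_piAntidiag s μ N
  rw [h1, one_pow] at this
  exact this.symm

lemma exists_close_composition {μ : ℕ → ℝ} {s : Finset ℕ} (h1 : ∑ k ∈ s, μ k = 1)
    (hm1 : ∑ k ∈ s, (k : ℝ) * μ k = 1) (hs0 : 0 ∈ s) {p : ℕ} (hp : 0 < p) (hps : p ∈ s)
    {N : ℕ} {m : ℕ → ℤ} (hm : ∑ k ∈ s, m k = N) (hkm : ∑ k ∈ s, k * m k = N - 1) :
    ∃ v : ℕ → ℤ, ∑ k ∈ s, v k = N ∧ ∑ k ∈ s, k * v k = N - 1 ∧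
      ∀ k ∈ s, |(v k : ℝ) - N * μ k| ≤ 1 + p + ∑ k ∈ s, (p + k * p : ℝ) := by
  set s' := (s.erase 0).erase p with hs'
  have split : ∀ {M : Type} [AddCommMonoid M] (g : ℕ → M),
      ∑ k ∈ s, g k = g 0 + (g p + ∑ k ∈ s', g k) := by
    intro M _ g
    rw [hs', Finset.add_sum_erase _ _ (Finset.mem_erase.2 ⟨hp.ne', hps⟩),
      Finset.add_sum_erase _ _ hs0]
  have hpR : (1 : ℝ) ≤ p := by exact_mod_cast hp
  have hp0 : (0 : ℝ) < p := by linarith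
  set t : ℕ → ℤ := fun k => ⌊((N : ℝ) * μ k - m k) / p⌋ with ht
  set v : ℕ → ℤ := fun k => if k = 0 then m 0 - ∑ i ∈ s', ((p : ℤ) - i) * t i
    else if k = p then m p - ∑ i ∈ s', (i : ℤ) * t i else m k + p * t k with hv
  have v0 : v 0 = m 0 - ∑ i ∈ s', ((p : ℤ) - i) * t i := by simp [hv]
  have vp : v p = m p - ∑ i ∈ s', (i : ℤ) * t i := by simp [hv, hp.ne']
  have vs : ∀ k ∈ s', v k = m k + p * t k := by
    intro k hk
    simp only [hs', Finset.mem_erase] at hk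
    simp [hv, hk.1, hk.2.1]
  have sum_v : ∑ k ∈ s, v k = N := by
    rw [← hm, split v, split m, v0, vp, Finset.sum_congr rfl vs, Finset.sum_add_distrib]
    have : ∑ i ∈ s', ((p : ℤ) - i) * t i = ∑ i ∈ s', (p : ℤ) * t i - ∑ i ∈ s', (i : ℤ) * t i := by
      rw [← Finset.sum_sub_distrib]
      exact Finset.sum_congr rfl fun _ _ => by ring
    rw [this]
    ring
  have sum_kv : ∑ k ∈ s, k * v k = N - 1 := by
    have hsk : ∑ k ∈ s', (k : ℤ) * v k = ∑ k ∈ s', (k : ℤ) * (m k + p * t k) :=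
      Finset.sum_congr rfl fun k hk => by rw [vs k hk]
    rw [← hkm, split fun k => (k : ℤ) * v k, split fun k => (k : ℤ) * m k, hsk, vp]
    simp_rw [mul_add, Finset.sum_add_distrib]
    have : ∑ k ∈ s', (k : ℤ) * (p * t k) = p * ∑ i ∈ s', (i : ℤ) * t i := by
      rw [Finset.mul_sum]
      exact Finset.sum_congr rfl fun _ _ => by ring
    rw [this]
    push_cast
    ring
  refine ⟨v, sum_v, sum_kv, ?_⟩
  set e : ℕ → ℝ := fun k => (v k : ℝ) - N * μ k with he
  have hes : ∀ k ∈ s', -(p : ℝ) ≤ e k ∧ e k ≤ 0 := by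
    intro k hk
    have h₁ := Int.floor_le (((N : ℝ) * μ k - m k) / p)
    have h₂ := Int.lt_floor_add_one (((N : ℝ) * μ k - m k) / p)
    rw [le_div_iff₀ hp0] at h₁
    rw [div_lt_iff₀ hp0] at h₂
    simp only [he, vs k hk, ht]
    push_cast
    constructor <;> linarith
  have esum : e 0 + (e p + ∑ k ∈ s', e k) = 0 := by
    rw [← split e]
    simp only [he, Finset.sum_sub_distrib, ← Finset.mul_sum, h1]
    have : ∑ k ∈ s, (v k : ℝ) = N := by exact_mod_cast sum_v
    rw [this]
    ring
  have eksum : p * e p + ∑ k ∈ s', k * e k = -1 := by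
    have : ∑ k ∈ s, (k : ℝ) * e k = -1 := by
      simp only [he, mul_sub, Finset.sum_sub_distrib]
      have h₁ : ∑ k ∈ s, (k : ℝ) * v k = N - 1 := by exact_mod_cast sum_kv
      have h₂ : ∑ k ∈ s, (k : ℝ) * (N * μ k) = N := by
        calc ∑ k ∈ s, (k : ℝ) * (N * μ k) = N * ∑ k ∈ s, (k : ℝ) * μ k := by
              rw [Finset.mul_sum]
              exact Finset.sum_congr rfl fun _ _ => by ring
          _ = N := by rw [hm1, mul_one]
      rw [h₁, h₂]
      ring
    rw [split fun k => (k : ℝ) * e k] at this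
    simpa using this
  have hsub : s' ⊆ s := (Finset.erase_subset _ _).trans (Finset.erase_subset _ _)
  have hB : ∑ k ∈ s', (p : ℝ) + ∑ k ∈ s', (k * p : ℝ) ≤ ∑ k ∈ s, (p + k * p : ℝ) := by
    rw [← Finset.sum_add_distrib]
    exact Finset.sum_le_sum_of_subset_of_nonneg hsub fun k _ _ => by positivity
  have hB1 : 0 ≤ ∑ k ∈ s', (p : ℝ) := Finset.sum_nonneg fun _ _ => hp0.le
  have hB2 : 0 ≤ ∑ k ∈ s', (k * p : ℝ) := Finset.sum_nonneg fun _ _ => by positivity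
  have hE1 : -∑ k ∈ s', (p : ℝ) ≤ ∑ k ∈ s', e k := by
    rw [← Finset.sum_neg_distrib]
    exact Finset.sum_le_sum fun k hk => (hes k hk).1
  have hE1' : ∑ k ∈ s', e k ≤ 0 := Finset.sum_nonpos fun k hk => (hes k hk).2
  have hE2 : -∑ k ∈ s', (k * p : ℝ) ≤ ∑ k ∈ s', k * e k := by
    rw [← Finset.sum_neg_distrib]
    refine Finset.sum_le_sum fun k hk => ?_
    rw [← mul_neg]
    exact mul_le_mul_of_nonneg_left (hes k hk).1 (Nat.cast_nonneg _)
  have hE2' : ∑ k ∈ s', k * e k ≤ 0 :=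
    Finset.sum_nonpos fun k hk => mul_nonpos_of_nonneg_of_nonpos (Nat.cast_nonneg _) (hes k hk).2
  have hep : -1 ≤ e p ∧ e p ≤ ∑ k ∈ s', (k * p : ℝ) := by
    constructor <;> nlinarith
  intro k hk
  change |e k| ≤ _
  rw [abs_le]
  by_cases hk0 : k = 0
  · subst hk0
    constructor <;> linarith [hep.1, hep.2]
  · by_cases hkp : k = p
    · subst hkp
      constructor <;> linarith [hep.1, hep.2]
    · have := hes k (Finset.mem_erase.2 ⟨hkp, Finset.mem_erase.2 ⟨hk0, hk⟩⟩)
      constructor <;> linarith [this.1, this.2]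

lemma H1.exists_support {μ : ℕ → ℝ} {K : ℕ} (hμ : H1 μ K) :
    ∃ s : Finset ℕ, (∀ k ∈ s, 0 < μ k) ∧ (∀ k, k ∉ s → μ k = 0) ∧ ∑ k ∈ s, μ k = 1 ∧
      ∑ k ∈ s, (k : ℝ) * μ k = 1 ∧ 0 ∈ s ∧ ∃ p ∈ s, 0 < p := by
  obtain ⟨h0, h1, hnd, hm, -, hK⟩ := hμ
  set s := (Finset.range (K + 1)).filter fun k => 0 < μ k with hs
  have hpos : ∀ k ∈ s, 0 < μ k := fun k hk => (Finset.mem_filter.1 hk).2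
  have hout : ∀ k, k ∉ s → μ k = 0 := by
    intro k hk
    by_contra hne
    have hk' : k ≤ K := by
      by_contra! hlt
      exact hne (hK k hlt)
    exact hk (Finset.mem_filter.2
      ⟨Finset.mem_range.2 (by omega), lt_of_le_of_ne (h0 k) (Ne.symm hne)⟩)
  have hs1 : ∑ k ∈ s, μ k = 1 := (hasSum_sum_of_ne_finset_zero hout).unique h1
  have hsm : ∑ k ∈ s, (k : ℝ) * μ k = 1 :=
    (hasSum_sum_of_ne_finset_zero fun k hk => by rw [hout k hk, mul_zero]).unique hm
  refine ⟨s, hpos, hout, hs1, hsm, ?_, ?_⟩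
  · by_contra hz
    have hge : ∀ k ∈ s, 0 ≤ ((k : ℝ) - 1) * μ k := by
      intro k hk
      have : k ≠ 0 := fun h => hz (h ▸ hk)
      have : (1 : ℝ) ≤ k := by exact_mod_cast Nat.one_le_iff_ne_zero.2 this
      exact mul_nonneg (by linarith) (h0 k)
    have hsum : ∑ k ∈ s, ((k : ℝ) - 1) * μ k = 0 := by
      simp_rw [sub_mul, one_mul, Finset.sum_sub_distrib, hsm, hs1, sub_self]
    have hall := (Finset.sum_eq_zero_iff_of_nonneg hge).1 hsum
    have hs' : s ⊆ {1} := by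
      intro k hk
      rcases mul_eq_zero.1 (hall k hk) with h | h
      · rw [Finset.mem_singleton]
        have : (k : ℝ) = 1 := by linarith
        exact_mod_cast this
      · exact absurd h (hpos k hk).ne'
    have h1' : μ 1 = 1 := by
      rw [← hs1, Finset.sum_subset hs' fun k _ hk => hout k hk, Finset.sum_singleton]
    exact hnd (by rw [hout 0 hz, h1', zero_add])
  · by_contra! hz
    have : ∑ k ∈ s, (k : ℝ) * μ k = 0 := Finset.sum_eq_zero fun k hk => by
      rw [Nat.le_zero.1 (hz k hk)]; simp
    linarith

lemma exists_le_coeff_pow_mul {μ : ℕ → ℝ} {K : ℕ} (hμ : H1 μ K) :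
    ∃ c > (0 : ℝ), ∃ D : ℕ, ∀ᶠ n : ℕ in atTop,
      PowerSeries.coeff n (PowerSeries.mk μ ^ (n + 1)) ≠ 0 →
        c ≤ PowerSeries.coeff n (PowerSeries.mk μ ^ (n + 1)) * ((n : ℝ) + 2) ^ D := by
  obtain ⟨s, hpos, hout, hs1, hsm, hs0, p, hps, hp⟩ := hμ.exists_support
  have h0 := hμ.1
  set C : ℝ := 1 + p + ∑ k ∈ s, (p + k * p : ℝ) with hCdef
  have hC : 0 < C := by positivity
  refine ⟨Real.exp (-∑ k ∈ s, 2 * C / μ k), Real.exp_pos _, s.card, ?_⟩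
  have hlarge : ∀ᶠ n : ℕ in atTop, ∀ k ∈ s, 2 * C ≤ ((n + 1 : ℕ) : ℝ) * μ k := by
    rw [Filter.eventually_all_finset]
    intro k hk
    have : Tendsto (fun n : ℕ => ((n + 1 : ℕ) : ℝ) * μ k) atTop atTop :=
      ((tendsto_natCast_atTop_atTop (R := ℝ)).comp (tendsto_add_atTop_nat 1)).atTop_mul_const
        (hpos k hk)
    exact this.eventually_ge_atTop _
  filter_upwards [hlarge] with n hn hne
  rw [coeff_mk_pow μ s hout] at hne ⊢
  obtain ⟨m, hm, hmne⟩ := Finset.exists_ne_zero_of_sum_ne_zero hne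
  have hkm : ∑ k ∈ s, k * m k = n := by
    by_contra h
    exact hmne (if_neg h)
  obtain ⟨v, hv, hkv, hvC⟩ := exists_close_composition hs1 hsm hs0 hp hps (N := n + 1)
    (m := fun k => (m k : ℤ))
    (by exact_mod_cast (Finset.mem_piAntidiag.1 hm).1)
    (by push_cast; rw [add_sub_cancel_right]; exact_mod_cast hkm)
  have hv0 : ∀ k ∈ s, 0 ≤ v k := by
    intro k hk
    have h₁ := (abs_le.1 (hvC k hk)).1
    have h₂ := hn k hk
    have : (0 : ℝ) ≤ v k := by linarith
    exact_mod_cast this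
  set w : ℕ → ℕ := fun k => if k ∈ s then (v k).toNat else 0 with hw
  have hwv : ∀ k ∈ s, (w k : ℤ) = v k := by
    intro k hk
    simp only [hw, if_pos hk]
    exact Int.toNat_of_nonneg (hv0 k hk)
  have hwsum : ∑ k ∈ s, w k = n + 1 := by
    have : ∑ k ∈ s, (w k : ℤ) = (n + 1 : ℕ) := by rw [Finset.sum_congr rfl hwv, hv]
    exact_mod_cast this
  have hwk : ∑ k ∈ s, k * w k = n := by
    have : ∑ k ∈ s, (k : ℤ) * (w k : ℤ) = n := by
      rw [Finset.sum_congr rfl fun k hk => by rw [hwv k hk], hkv]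
      push_cast
      ring
    exact_mod_cast this
  have hwmem : w ∈ s.piAntidiag (n + 1) := by
    refine Finset.mem_piAntidiag.2 ⟨hwsum, fun k hk => ?_⟩
    by_contra hks
    exact hk (if_neg hks)
  have hwC : ∀ k ∈ s, |(w k : ℝ) - (n + 1 : ℕ) * μ k| ≤ C := by
    intro k hk
    have : (w k : ℝ) = v k := by exact_mod_cast hwv k hk
    rw [this]
    exact hvC k hk
  have hcoeff : multinomialWeight μ s w ≤ ∑ v ∈ s.piAntidiag (n + 1),
      if ∑ k ∈ s, k * v k = n then multinomialWeight μ s v else 0 := by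
    have := Finset.single_le_sum (s := s.piAntidiag (n + 1)) (f := fun v : ℕ → ℕ =>
      if ∑ k ∈ s, k * v k = n then multinomialWeight μ s v else 0) (fun v _ => by
        split_ifs
        · exact multinomialWeight_nonneg h0 s v
        · exact le_rfl) hwmem
    simpa only [if_pos hwk] using this
  calc Real.exp (-∑ k ∈ s, 2 * C / μ k)
      = ∑ u ∈ s.piAntidiag (n + 1),
          multinomialWeight μ s u * Real.exp (-∑ k ∈ s, 2 * C / μ k) := by
        rw [← Finset.sum_mul, sum_multinomialWeight hs1, one_mul]
    _ ≤ ∑ u ∈ s.piAntidiag (n + 1), multinomialWeight μ s w := by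
        refine Finset.sum_le_sum fun u hu => ?_
        exact multinomialWeight_mul_exp_le h0 hpos (Nat.succ_pos n) hwsum
          (Finset.mem_piAntidiag.1 hu).1 hC hn hwC
    _ = multinomialWeight μ s w * (s.piAntidiag (n + 1)).card := by
        rw [Finset.sum_const, nsmul_eq_mul, mul_comm]
    _ ≤ _ := by
        refine mul_le_mul hcoeff ?_ (Nat.cast_nonneg _)
          ((multinomialWeight_nonneg h0 s w).trans hcoeff)
        have := card_piAntidiag_le s (n + 1)
        have h₂ : ((s.piAntidiag (n + 1)).card : ℝ) ≤ ((n : ℝ) + 1 + 1) ^ s.card := by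
          exact_mod_cast this
        rwa [add_assoc, one_add_one_eq_two] at h₂

/-- The weight `exp (-θ μ_k l - |θ| x)` normalising `expSum` in the Chernoff bound. -/
def tailSum (q x : ℝ) (θ : ℝ) (k j m l : ℕ) (T : PlanarTree) : ℝ≥0∞ :=
  ENNReal.ofReal (Real.exp (-(θ * (q * l)) - |θ| * x)) * expSum θ k j m l T

theorem tsum_gwMass_mul_tailSum_le {μ : ℕ → ℝ} (h0 : ∀ k, 0 ≤ μ k) (h1 : HasSum μ 1)
    (hm : HasSum (fun k : ℕ => (k : ℝ) * μ k) 1) {k j m l : ℕ} (hj : 1 ≤ j) (hjk : j ≤ k)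
    (hl0 : 0 < l) (hl : l ≤ m) {x θ : ℝ} (hθ : |θ| = x / (2 * l)) :
    ∑' T, gwMass μ T * tailSum (μ k) x θ k j m l T
      ≤ ENNReal.ofReal (Real.exp (-(x ^ 2 / (4 * l)))) := by
  have hl' : (0 : ℝ) < l := by exact_mod_cast hl0
  have hk1 : μ k ≤ 1 := le_hasSum h1 k fun i _ => h0 i
  have hb := one_add_mul_exp_sub_one_le (h0 k) hk1 θ
  have hb0 : 0 ≤ 1 + μ k * (Real.exp θ - 1) := by
    have := mul_nonneg (h0 k) (Real.exp_pos θ).le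
    linarith
  simp_rw [tailSum, mul_left_comm (gwMass μ _)]
  rw [ENNReal.tsum_mul_left]
  refine (mul_le_mul_right (tsum_gwMass_mul_expSum_le h0 h1 hm θ hj hjk m l hl) _).trans ?_
  rw [← ENNReal.ofReal_pow hb0, ← ENNReal.ofReal_mul (Real.exp_pos _).le]
  refine ENNReal.ofReal_le_ofReal ?_
  calc Real.exp (-(θ * (μ k * l)) - |θ| * x) * (1 + μ k * (Real.exp θ - 1)) ^ l
      ≤ Real.exp (-(θ * (μ k * l)) - |θ| * x) * Real.exp (μ k * θ + θ ^ 2) ^ l := by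
        gcongr
    _ = Real.exp (-(x ^ 2 / (4 * l))) := by
        rw [← Real.exp_nat_mul, ← Real.exp_add, ← sq_abs θ, hθ]
        congr 1
        field_simp
        ring

theorem one_le_tailSum_add {T : PlanarTree} {u : List ℕ} (hu : u ∈ T.val) {k j l : ℕ}
    {q x θ : ℝ} (hθ : 0 ≤ θ) (hx : x ≤ |(AcountLe T u l k j : ℝ) - q * l|) :
    1 ≤ tailSum q x θ k j u.length l T + tailSum q x (-θ) k j u.length l T := by
  have key (φ : ℝ) (h : |φ| * x ≤ φ * ((AcountLe T u l k j : ℝ) - q * l)) :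
      1 ≤ tailSum q x φ k j u.length l T := by
    have h₁ : ENNReal.ofReal (Real.exp (φ * AcountLe T u l k j)) ≤ expSum φ k j u.length l T := by
      refine le_trans (le_of_eq ?_) (Finset.single_le_sum (f := fun v : List ℕ =>
        if v.length = u.length then ENNReal.ofReal (Real.exp (φ * AcountLe T v l k j)) else 0)
        (fun _ _ => zero_le) hu)
      simp
    refine le_trans ?_ (mul_le_mul_right h₁ _)
    rw [← ENNReal.ofReal_mul (Real.exp_pos _).le, ← Real.exp_add, ENNReal.one_le_ofReal,
      Real.one_le_exp_iff]
    linarith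
  rcases le_abs'.1 hx with h | h
  · refine (key (-θ) ?_).trans le_add_self
    rw [abs_neg, abs_of_nonneg hθ]
    nlinarith
  · refine (key θ ?_).trans le_self_add
    rw [abs_of_nonneg hθ]
    exact mul_le_mul_of_nonneg_left h hθ

/-- The trees with a vertex `u` and a length `l` at which some count `A_{u,l,k,j}` deviates from
its mean by at least `γ √(l L)`. -/
def deviationSet (μ : ℕ → ℝ) (K : ℕ) (γ L : ℝ) : Set PlanarTree :=
  {T | ∃ p : IK K, ∃ u ∈ T.val, ∃ l : ℕ, 0 < l ∧ l ≤ u.length ∧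
    γ * Real.sqrt ((l : ℝ) * L) ≤
      |(AcountLe T u l p.val.1 p.val.2 : ℝ) - μ p.val.1 * (l : ℝ)|}

theorem tsum_deviationSet_le {μ : ℕ → ℝ} (h0 : ∀ k, 0 ≤ μ k) (h1 : HasSum μ 1)
    (hm : HasSum (fun k : ℕ => (k : ℝ) * μ k) 1) (K n : ℕ) {γ L : ℝ} (hγ : 0 ≤ γ) (hL : 0 ≤ L) :
    (∑' T, if T ∈ deviationSet μ K γ L ∩ {T | T.val.card = n + 1} then gwMass μ T else 0)
      ≤ ENNReal.ofReal (2 * (IKfin K).card * ((n : ℝ) + 1) ^ 2 * Real.exp (-(γ ^ 2 * L / 4))) := by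
  set I := IKfin K ×ˢ ((Finset.range (n + 1)) ×ˢ (Finset.range (n + 1))) with hI
  set J := I.filter fun a => 0 < a.2.2 ∧ a.2.2 ≤ a.2.1 with hJ
  set X : ℕ → ℝ := fun l => γ * Real.sqrt ((l : ℝ) * L) with hX
  set θ : ℕ → ℝ := fun l => X l / (2 * l) with hθ
  have hX0 (l : ℕ) : 0 ≤ X l := by positivity
  have hθ0 (l : ℕ) : 0 ≤ θ l := by have := hX0 l; positivity
  have hXsq (l : ℕ) (hl : 0 < l) : X l ^ 2 / (4 * l) = γ ^ 2 * L / 4 := by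
    have : (0 : ℝ) < l := by exact_mod_cast hl
    simp only [hX]
    rw [mul_pow, Real.sq_sqrt (by positivity)]
    field_simp
  set F : (ℕ × ℕ) × (ℕ × ℕ) → PlanarTree → ℝ≥0∞ := fun a T =>
    tailSum (μ a.1.1) (X a.2.2) (θ a.2.2) a.1.1 a.1.2 a.2.1 a.2.2 T
      + tailSum (μ a.1.1) (X a.2.2) (-θ a.2.2) a.1.1 a.1.2 a.2.1 a.2.2 T with hF
  have hpt (T : PlanarTree) :
      (if T ∈ deviationSet μ K γ L ∩ {T | T.val.card = n + 1} then gwMass μ T else 0)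
        ≤ ∑ a ∈ J, gwMass μ T * F a T := by
    split_ifs with hT
    swap
    · exact zero_le
    obtain ⟨⟨p, u, hu, l, hl0, hl, hdev⟩, hcard⟩ := hT
    have hlen : u.length < n + 1 := by
      have hcard' : T.val.card = n + 1 := hcard
      exact hcard' ▸ length_lt_card T hu
    have hmem : (p.val, (u.length, l)) ∈ J := by
      simp only [hJ, hI, Finset.mem_filter, Finset.mem_product, Finset.mem_range]
      exact ⟨⟨p.property, hlen, by omega⟩, hl0, hl⟩
    refine le_trans ?_ (Finset.single_le_sum (f := fun a => gwMass μ T * F a T)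
      (fun _ _ => zero_le) hmem)
    exact le_mul_of_one_le_right zero_le (one_le_tailSum_add hu (hθ0 l) hdev)
  have hterm (a) (ha : a ∈ J) : ∑' T, gwMass μ T * F a T
      ≤ ENNReal.ofReal (2 * Real.exp (-(γ ^ 2 * L / 4))) := by
    simp only [hJ, hI, Finset.mem_filter, Finset.mem_product, IKfin] at ha
    obtain ⟨⟨⟨_, hj, hjk⟩, _⟩, hl0, hl⟩ := ha
    simp only [hF, mul_add]
    rw [ENNReal.tsum_add, two_mul, ENNReal.ofReal_add (Real.exp_pos _).le (Real.exp_pos _).le,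
      ← hXsq _ hl0]
    refine add_le_add (tsum_gwMass_mul_tailSum_le h0 h1 hm hj hjk hl0 hl ?_)
      (tsum_gwMass_mul_tailSum_le h0 h1 hm hj hjk hl0 hl ?_)
    · exact abs_of_nonneg (hθ0 _)
    · rw [abs_neg]
      exact abs_of_nonneg (hθ0 _)
  refine (ENNReal.tsum_le_tsum hpt).trans ?_
  rw [Summable.tsum_finsetSum fun _ _ => ENNReal.summable]
  refine (Finset.sum_le_card_nsmul _ _ _ hterm).trans ?_
  rw [← ENNReal.ofReal_nsmul, nsmul_eq_mul]
  refine ENNReal.ofReal_le_ofReal ?_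
  have hc : (J.card : ℝ) ≤ (IKfin K).card * ((n : ℝ) + 1) ^ 2 := by
    have : J.card ≤ (IKfin K).card * ((n + 1) * (n + 1)) := by
      refine (Finset.card_filter_le _ _).trans (le_of_eq ?_)
      rw [hI, Finset.card_product, Finset.card_product, Finset.card_range]
    calc (J.card : ℝ) ≤ ((IKfin K).card * ((n + 1) * (n + 1)) : ℕ) := by exact_mod_cast this
      _ = _ := by push_cast; ring
  calc (J.card : ℝ) * (2 * Real.exp (-(γ ^ 2 * L / 4)))
      ≤ ((IKfin K).card * ((n : ℝ) + 1) ^ 2) * (2 * Real.exp (-(γ ^ 2 * L / 4))) := by gcongr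
    _ = _ := by ring

theorem condProb_deviationSet_le {μ : ℕ → ℝ} {K : ℕ} (hμ : H1 μ K) {γ L : ℝ} (hγ : 0 ≤ γ)
    (hL : 0 ≤ L) {n D : ℕ} {b : ℝ} (hb : 0 < b)
    (hcoeff : PowerSeries.coeff n (PowerSeries.mk μ ^ (n + 1)) ≠ 0 →
      b ≤ PowerSeries.coeff n (PowerSeries.mk μ ^ (n + 1)) * ((n : ℝ) + 2) ^ D) :
    condProb μ n (deviationSet μ K γ L)
      ≤ 2 * (IKfin K).card / b * ((n : ℝ) + 2) ^ (D + 3) * Real.exp (-(γ ^ 2 * L / 4)) := by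
  obtain ⟨h0, h1, -, hm, -, -⟩ := hμ
  have hsize := mul_treeSizeProb h0 h1 n
  unfold condProb
  set t := treeSizeProb μ (n + 1)
  by_cases ht : t = 0
  · rw [ht, div_zero]
    positivity
  have hn : (0 : ℝ) < (n : ℝ) + 1 := by positivity
  have hb' := hcoeff (by rw [← hsize]; exact mul_ne_zero hn.ne' ht)
  rw [← hsize] at hb'
  have ht0 : 0 < t := by
    by_contra! h
    have : ((n : ℝ) + 1) * t * ((n : ℝ) + 2) ^ D ≤ 0 :=
      mul_nonpos_of_nonpos_of_nonneg (mul_nonpos_of_nonneg_of_nonpos hn.le h) (by positivity)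
    linarith
  rw [div_le_iff₀ ht0, toReal_tsum_eq_gwProb h0]
  have htsum := tsum_deviationSet_le h0 h1 hm K n hγ hL
  refine (ENNReal.toReal_le_of_le_ofReal (by positivity)
    (le_trans (le_of_eq ?_) htsum)).trans ?_
  · congr!
  set E := Real.exp (-(γ ^ 2 * L / 4))
  have hE : 0 < E := Real.exp_pos _
  calc 2 * (IKfin K).card * ((n : ℝ) + 1) ^ 2 * E
      = 2 * (IKfin K).card / b * ((n : ℝ) + 1) ^ 2 * E * b := by field_simp
    _ ≤ 2 * (IKfin K).card / b * ((n : ℝ) + 1) ^ 2 * E *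
          (((n : ℝ) + 1) * t * ((n : ℝ) + 2) ^ D) := by gcongr
    _ = 2 * (IKfin K).card / b * (((n : ℝ) + 1) ^ 3 * ((n : ℝ) + 2) ^ D) * E * t := by ring
    _ ≤ 2 * (IKfin K).card / b * (((n : ℝ) + 2) ^ 3 * ((n : ℝ) + 2) ^ D) * E * t := by
        gcongr
        linarith
    _ = 2 * (IKfin K).card / b * ((n : ℝ) + 2) ^ (D + 3) * E * t := by ring

/-- Assume (H1).  For every `c > 0` there exists `γ > 0` such that, for `n` large
enough, `P_n(∃ (k,j) ∈ I_K, ∃ u ∈ T, ∃ l ∈ (0,|u|],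
|A_{u,l,k,j} - μ_k l| ≥ γ √(l log n)) ≤ n^{-c}`. -/
theorem statement10
    (μ : ℕ → ℝ) (K : ℕ) (hμ : H1 μ K) (c : ℝ) (hc : 0 < c) :
    ∃ γ > (0 : ℝ), ∀ᶠ n : ℕ in atTop,
      condProb μ n
        {T | ∃ p : IK K, ∃ u ∈ T.val, ∃ l : ℕ, 0 < l ∧ l ≤ u.length ∧
          γ * Real.sqrt ((l : ℝ) * Real.log n) ≤
            |(AcountLe T u l p.val.1 p.val.2 : ℝ) - μ p.val.1 * (l : ℝ)|}
        ≤ (n : ℝ) ^ (-c) := by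
  obtain ⟨b, hb, D, hev⟩ := exists_le_coeff_pow_mul hμ
  refine ⟨2 * Real.sqrt (c + (D + 4 : ℕ)), by positivity, ?_⟩
  set C : ℝ := 2 * (IKfin K).card / b * 2 ^ (D + 3)
  filter_upwards [hev, eventually_ge_atTop 2, eventually_ge_atTop ⌈C⌉₊] with n hn hn2 hnC
  have hn2' : (2 : ℝ) ≤ n := by exact_mod_cast hn2
  have hn0 : (0 : ℝ) < n := by linarith
  refine (condProb_deviationSet_le hμ (by positivity) (Real.log_nonneg (by linarith)) hb
    hn).trans ?_
  have hexp : Real.exp (-((2 * Real.sqrt (c + (D + 4 : ℕ))) ^ 2 * Real.log n / 4))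
      = (n : ℝ) ^ (-c) * ((n : ℝ) ^ (D + 4))⁻¹ := by
    rw [mul_pow, Real.sq_sqrt (by positivity), ← Real.rpow_natCast (n : ℝ), ← Real.rpow_neg hn0.le,
      ← Real.rpow_add hn0, Real.rpow_def_of_pos hn0]
    congr 1
    ring
  rw [hexp]
  calc 2 * (IKfin K).card / b * ((n : ℝ) + 2) ^ (D + 3) * ((n : ℝ) ^ (-c) * ((n : ℝ) ^ (D + 4))⁻¹)
      ≤ 2 * (IKfin K).card / b * (2 * (n : ℝ)) ^ (D + 3) *
          ((n : ℝ) ^ (-c) * ((n : ℝ) ^ (D + 4))⁻¹) := by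
        gcongr
        linarith
    _ = C / n * (n : ℝ) ^ (-c) := by
        simp only [C]
        rw [mul_pow, pow_succ (n : ℝ) (D + 3)]
        field_simp
    _ ≤ 1 * (n : ℝ) ^ (-c) := by
        gcongr
        exact (div_le_one hn0).2 ((Nat.le_ceil C).trans (by exact_mod_cast hnC))
    _ = (n : ℝ) ^ (-c) := one_mul _

end
end

section
/- Assume (H1). For every integer h ≥ 0 and m ∈ {0,...,n}, P_n(|u(m)| = h) = P( |f_{N_1(ℳ^{(h)})}| = m − h and |f'_{1+N_2(ℳ^{(h)})}| = n + 1 − m ) / P(|𝐓| = n + 1), where ℳ^{(h)} is a multinomial random vector with parameters h and p, independent of the two independent Galton–Watson forests f and f' whose (random) numbers of roots are N_1(ℳ^{(h)}) and 1 + N_2(ℳ^{(h)}) respectively. -/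
open scoped Classical
open Filter
noncomputable section

/-- The multinomial probability `Q_h({m})` with parameters `h` and `p = (p_{k,j})`,
`p_{k,j} = μ_k`. -/
def Qmult (μ : ℕ → ℝ) (K h : ℕ) (m : IK K → ℕ) : ℝ :=
  if (∑ i, m i) = h then
    ((h.factorial : ℝ) / ∏ i, ((m i).factorial : ℝ)) * ∏ i : IK K, μ i.val.1 ^ m i
  else 0

/-- `N₁(a) = ∑_{(k,j)} (j-1) a_{k,j}`. -/
def N1 {K : ℕ} (a : IK K → ℕ) : ℕ := ∑ i, (i.val.2 - 1) * a i

/-- `N₂(a) = ∑_{(k,j)} (k-j) a_{k,j}`. -/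
def N2 {K : ℕ} (a : IK K → ℕ) : ℕ := ∑ i, (i.val.1 - i.val.2) * a i

/-- Variance of `μ` (whose mean is 1 under (H1)). -/
def gwVar (μ : ℕ → ℝ) : ℝ := ∑' k : ℕ, ((k : ℝ) - 1) ^ 2 * μ k

/-- The set `J_h` of contents `a ∈ ℕ^{I_K}` with `∑ a = h` whose `N₁` and `N₂` lie in
`[σ²h/2 - h^{2/3}, σ²h/2 + h^{2/3}]`. -/
def Jset (μ : ℕ → ℝ) (K h : ℕ) : Set (IK K → ℕ) :=
  {a | (∑ i, a i) = h ∧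
    |(N1 a : ℝ) - gwVar μ * h / 2| ≤ (h : ℝ) ^ ((2 : ℝ) / 3) ∧
    |(N2 a : ℝ) - gwVar μ * h / 2| ≤ (h : ℝ) ^ ((2 : ℝ) / 3)}

/-- `P(|f_k| = n)`: probability that a forest of `k` i.i.d. Galton-Watson trees has
total size (number of vertices) `n`. -/
def forestSizeProb (μ : ℕ → ℝ) : ℕ → ℕ → ℝ
  | 0, n => if n = 0 then 1 else 0
  | k + 1, n => ∑ m ∈ Finset.range (n + 1), treeSizeProb μ m * forestSizeProb μ k (n - m)

/-- Forest size probability with an integer size (`0` for negative sizes). -/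
def forestSizeProbZ (μ : ℕ → ℝ) (k : ℕ) (z : ℤ) : ℝ :=
  if 0 ≤ z then forestSizeProb μ k z.toNat else 0

/-- The vertices, in depth-first order, of the planar forest encoded by a binary tree `f`
(left subtree: descendants of the first root, right subtree: the other trees of the forest),
the roots being numbered from `i` on. -/
def forestWords : BinaryTree Unit → ℕ → List (List ℕ)
  | .nil, _ => []
  | .node _ c r, i => [i] :: ((forestWords c 1).map (List.cons i) ++ forestWords r (i + 1))

/-- The depths, in depth-first order, of the vertices of a forest, the roots having depth `0`. -/
def forestDepths : BinaryTree Unit → List ℕ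
  | .nil => []
  | .node _ c r => 0 :: ((forestDepths c).map Nat.succ ++ forestDepths r)

/-- The number of roots of a forest. -/
def rootCount : BinaryTree Unit → ℕ
  | .nil => 0
  | .node _ _ r => rootCount r + 1

/-- The Galton–Watson weight of a forest. -/
def forestWeight (μ : ℕ → ℝ) : BinaryTree Unit → ℝ
  | .nil => 1
  | .node _ c r => μ (rootCount c) * forestWeight μ c * forestWeight μ r

theorem length_forestDepths (f : BinaryTree Unit) : (forestDepths f).length = f.numNodes := by
  induction f with
  | nil => rfl
  | node _ c r hc hr => simp [forestDepths, BinaryTree.numNodes, hc, hr]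

theorem map_length_forestWords (f : BinaryTree Unit) (i : ℕ) :
    (forestWords f i).map List.length = (forestDepths f).map Nat.succ := by
  induction f generalizing i with
  | nil => rfl
  | node _ c r hc hr =>
    simp only [forestWords, forestDepths, List.map_cons, List.map_append, List.map_map, hr,
      ← hc 1]
    simp [Function.comp_def]

theorem exists_cons_of_mem_forestWords {f : BinaryTree Unit} {i : ℕ} {v : List ℕ}
    (hv : v ∈ forestWords f i) : ∃ a t, v = a :: t ∧ i ≤ a := by
  induction f generalizing i with
  | nil => simp [forestWords] at hv
  | node _ c r hc hr =>
    simp only [forestWords, List.mem_cons, List.mem_append, List.mem_map] at hv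
    rcases hv with rfl | ⟨w, -, rfl⟩ | hv
    · exact ⟨i, [], rfl, le_rfl⟩
    · exact ⟨i, w, rfl, le_rfl⟩
    · obtain ⟨a, t, rfl, h⟩ := hr hv
      exact ⟨a, t, rfl, by omega⟩

theorem nil_notMem_forestWords (f : BinaryTree Unit) (i : ℕ) : [] ∉ forestWords f i := by
  intro h
  obtain ⟨a, t, h, -⟩ := exists_cons_of_mem_forestWords h
  simp at h

theorem cons_mem_forestWords_node {x : Unit} {c r : BinaryTree Unit} {i : ℕ} {v : List ℕ} :
    i :: v ∈ forestWords (.node x c r) i ↔ v = [] ∨ v ∈ forestWords c 1 := by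
  have h : i :: v ∉ forestWords r (i + 1) := by
    intro h
    obtain ⟨a, t, h, h'⟩ := exists_cons_of_mem_forestWords h
    simp only [List.cons.injEq] at h
    omega
  simp [forestWords, h]

theorem cons_mem_forestWords_node_of_ne {x : Unit} {c r : BinaryTree Unit} {i a : ℕ}
    {v : List ℕ} (ha : a ≠ i) :
    a :: v ∈ forestWords (.node x c r) i ↔ a :: v ∈ forestWords r (i + 1) := by
  simp [forestWords, ha, ha.symm]

theorem pairwise_forestWords (f : BinaryTree Unit) (i : ℕ) :
    (forestWords f i).Pairwise (· < ·) := by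
  induction f generalizing i with
  | nil => simp [forestWords]
  | node _ c r hc hr =>
    rw [forestWords, List.pairwise_cons, List.pairwise_append]
    refine ⟨?_, ?_, hr _, ?_⟩
    · intro v hv
      rw [List.mem_append, List.mem_map] at hv
      rcases hv with ⟨w, hw, rfl⟩ | hv
      · obtain ⟨b, s, rfl, -⟩ := exists_cons_of_mem_forestWords hw
        exact List.Lex.cons List.Lex.nil
      · obtain ⟨a, t, rfl, h⟩ := exists_cons_of_mem_forestWords hv
        exact List.Lex.rel (by omega)
    · rw [List.pairwise_map]
      exact (hc 1).imp fun h => List.Lex.cons h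
    · intro v hv w hw
      rw [List.mem_map] at hv
      obtain ⟨v, -, rfl⟩ := hv
      obtain ⟨a, t, rfl, h⟩ := exists_cons_of_mem_forestWords hw
      exact List.Lex.rel (by omega)

theorem forestWords_injective {f g : BinaryTree Unit} {i : ℕ}
    (h : ∀ v, v ∈ forestWords f i ↔ v ∈ forestWords g i) : f = g := by
  induction f generalizing g i with
  | nil =>
    cases g with
    | nil => rfl
    | node _ c r => simpa [forestWords] using h [i]
  | node _ c r hc hr =>
    cases g with
    | nil => simpa [forestWords] using h [i]
    | node _ c' r' =>
      have h₁ : c = c' := hc (i := 1) fun v => by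
        rcases eq_or_ne v [] with rfl | hv
        · simp [nil_notMem_forestWords]
        · have := h (i :: v)
          simpa [cons_mem_forestWords_node, hv] using this
      have h₂ : r = r' := hr (i := i + 1) fun v => by
        rcases v with _ | ⟨a, v⟩
        · simp [nil_notMem_forestWords]
        · rcases eq_or_ne a i with rfl | ha
          · constructor <;> intro h <;>
              obtain ⟨b, t, h, h'⟩ := exists_cons_of_mem_forestWords h <;>
              simp only [List.cons.injEq] at h <;> omega
          · have := h (a :: v)
            rwa [cons_mem_forestWords_node_of_ne ha, cons_mem_forestWords_node_of_ne ha] at this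
      rw [h₁, h₂]

/-- A set of nonempty words is a planar forest with roots numbered from `i` on. -/
def IsForestFrom (i : ℕ) (S : Finset (List ℕ)) : Prop :=
  [] ∉ S ∧ (∀ j, [j] ∈ S → i ≤ j ∧ ∀ l, i ≤ l → l ≤ j → [l] ∈ S) ∧
    ∀ a u j, a :: (u ++ [j]) ∈ S →
      1 ≤ j ∧ a :: u ∈ S ∧ ∀ l, 1 ≤ l → l ≤ j → a :: (u ++ [l]) ∈ S

theorem isForestFrom_forestWords (f : BinaryTree Unit) (i : ℕ) :
    IsForestFrom i (forestWords f i).toFinset := by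
  induction f generalizing i with
  | nil => simp [IsForestFrom, forestWords]
  | node _ c r hc hr =>
    obtain ⟨-, hc₁, hc₂⟩ := hc 1
    obtain ⟨-, hr₁, hr₂⟩ := hr (i + 1)
    simp only [List.mem_toFinset] at hc₁ hc₂ hr₁ hr₂
    simp only [IsForestFrom, List.mem_toFinset]
    refine ⟨nil_notMem_forestWords _ _, ?_, ?_⟩
    · intro j hj
      rcases eq_or_ne j i with rfl | hji
      · refine ⟨le_rfl, fun l h₁ h₂ => ?_⟩
        rwa [le_antisymm h₂ h₁]
      · rw [cons_mem_forestWords_node_of_ne hji] at hj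
        obtain ⟨h₁, h₂⟩ := hr₁ j hj
        refine ⟨by omega, fun l hl hl' => ?_⟩
        rcases eq_or_ne l i with rfl | hli
        · simp [cons_mem_forestWords_node]
        · rw [cons_mem_forestWords_node_of_ne hli]
          exact h₂ l (by omega) hl'
    · intro a u j h
      rcases eq_or_ne a i with rfl | hai
      · simp only [cons_mem_forestWords_node, List.append_eq_nil_iff, List.cons_ne_nil,
          and_false, false_or] at h ⊢
        rcases u with _ | ⟨b, u⟩
        · obtain ⟨h₁, h₂⟩ := hc₁ j h
          exact ⟨h₁, Or.inl rfl, h₂⟩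
        · obtain ⟨h₁, h₂, h₃⟩ := hc₂ b u j h
          exact ⟨h₁, Or.inr h₂, h₃⟩
      · simp only [cons_mem_forestWords_node_of_ne hai] at h ⊢
        exact hr₂ a u j h

theorem IsForestFrom.exists_mem_singleton {i : ℕ} {S : Finset (List ℕ)} (hS : IsForestFrom i S)
    {v : List ℕ} (hv : v ∈ S) : [i] ∈ S := by
  induction v using List.reverseRecOn with
  | nil => exact absurd hv hS.1
  | append_singleton u j ih =>
    rcases u with _ | ⟨a, u⟩
    · exact (hS.2.1 j hv).2 i le_rfl (hS.2.1 j hv).1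
    · exact ih (hS.2.2 a u j hv).2.1

theorem IsForestFrom.exists_forestWords {i : ℕ} {S : Finset (List ℕ)} (hS : IsForestFrom i S) :
    ∃ f, S = (forestWords f i).toFinset := by
  induction hn : S.card using Nat.strong_induction_on generalizing S i with
  | _ n ih =>
    subst hn
    rcases S.eq_empty_or_nonempty with rfl | ⟨v, hv⟩
    · exact ⟨.nil, rfl⟩
    have hi := hS.exists_mem_singleton hv
    set C : Finset (List ℕ) := (S.preimage (List.cons i) List.cons_injective.injOn).erase []
      with hC
    set R : Finset (List ℕ) := S.filter fun v => v.head? ≠ some i with hR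
    have memC : ∀ v, v ∈ C ↔ v ≠ [] ∧ i :: v ∈ S := fun v => by simp [hC]
    have memR : ∀ a v, a :: v ∈ R ↔ a ≠ i ∧ a :: v ∈ S := fun a v => by simp [hR, and_comm]
    have cardC : C.card < S.card := by
      rw [← Finset.card_image_of_injective C (List.cons_injective (a := i))]
      refine Finset.card_lt_card (Finset.ssubset_iff_of_subset ?_ |>.2 ⟨[i], hi, ?_⟩)
      · intro w hw
        obtain ⟨u, hu, rfl⟩ := Finset.mem_image.1 hw
        exact ((memC u).1 hu).2
      · simp [hC]
    have cardR : R.card < S.card :=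
      Finset.card_lt_card (Finset.filter_ssubset.2 ⟨[i], hi, by simp⟩)
    have forC : IsForestFrom 1 C := by
      refine ⟨by simp [hC], fun j hj => ?_, fun a u j h => ?_⟩
      · obtain ⟨h₁, -, h₂⟩ := hS.2.2 i [] j ((memC _).1 hj).2
        exact ⟨h₁, fun l hl hl' => (memC _).2 ⟨by simp, h₂ l hl hl'⟩⟩
      · obtain ⟨h₁, h₂, h₃⟩ := hS.2.2 i (a :: u) j ((memC _).1 h).2
        exact ⟨h₁, (memC _).2 ⟨by simp, h₂⟩, fun l hl hl' => (memC _).2 ⟨by simp, h₃ l hl hl'⟩⟩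
    have forR : IsForestFrom (i + 1) R := by
      refine ⟨by simp [hR, hS.1], fun j hj => ?_, fun a u j h => ?_⟩
      · obtain ⟨hj, hjS⟩ := (memR _ _).1 hj
        obtain ⟨h₁, h₂⟩ := hS.2.1 j hjS
        exact ⟨by omega, fun l hl hl' => (memR _ _).2 ⟨by omega, h₂ l (by omega) hl'⟩⟩
      · obtain ⟨ha, haS⟩ := (memR _ _).1 h
        obtain ⟨h₁, h₂, h₃⟩ := hS.2.2 a u j haS
        exact ⟨h₁, (memR _ _).2 ⟨ha, h₂⟩, fun l hl hl' => (memR _ _).2 ⟨ha, h₃ l hl hl'⟩⟩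
    obtain ⟨c, hc⟩ := ih _ cardC forC rfl
    obtain ⟨r, hr⟩ := ih _ cardR forR rfl
    refine ⟨.node () c r, ?_⟩
    ext v
    rcases v with _ | ⟨a, v⟩
    · simp [hS.1, nil_notMem_forestWords]
    rw [List.mem_toFinset]
    rcases eq_or_ne a i with rfl | ha
    · rw [cons_mem_forestWords_node, ← List.mem_toFinset, ← hc, memC]
      rcases eq_or_ne v [] with rfl | hv
      · simp [hi]
      · simp [hv]
    · rw [cons_mem_forestWords_node_of_ne ha, ← List.mem_toFinset, ← hr, memR]
      simp [ha]

/-- The vertices, in depth-first order, of the planar tree whose non-root vertices form the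
forest `c`. -/
def treeWords (c : BinaryTree Unit) : List (List ℕ) := [] :: forestWords c 1

theorem pairwise_treeWords (c : BinaryTree Unit) : (treeWords c).Pairwise (· < ·) := by
  refine List.pairwise_cons.2 ⟨fun v hv => ?_, pairwise_forestWords c 1⟩
  obtain ⟨a, t, rfl, -⟩ := exists_cons_of_mem_forestWords hv
  exact List.Lex.nil

theorem isPlanarTree_treeWords (c : BinaryTree Unit) : IsPlanarTree (treeWords c).toFinset := by
  obtain ⟨-, h₁, h₂⟩ := isForestFrom_forestWords c 1
  simp only [List.mem_toFinset] at h₁ h₂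
  refine ⟨by simp [treeWords], fun u j h => ?_⟩
  simp only [treeWords, List.mem_toFinset, List.mem_cons, List.append_eq_nil_iff,
    List.cons_ne_nil, and_false, false_or] at h ⊢
  rcases u with _ | ⟨a, u⟩
  · exact ⟨(h₁ j h).1, Or.inl rfl, (h₁ j h).2⟩
  · obtain ⟨h₁, h₂, h₃⟩ := h₂ a u j h
    exact ⟨h₁, Or.inr h₂, h₃⟩

/-- Planar trees are encoded by the forests of their non-root vertices. -/
def planarTreeEquiv : BinaryTree Unit ≃ PlanarTree :=
  Equiv.ofBijective (fun c => ⟨(treeWords c).toFinset, isPlanarTree_treeWords c⟩) <| by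
    constructor
    · intro f g h
      have h : (treeWords f).toFinset = (treeWords g).toFinset := congrArg Subtype.val h
      refine forestWords_injective (i := 1) fun v => ?_
      rcases eq_or_ne v [] with rfl | hv
      · simp [nil_notMem_forestWords]
      · simpa [treeWords, hv] using Finset.ext_iff.1 h v
    · rintro ⟨T, hT₀, hT⟩
      have : IsForestFrom 1 (T.erase []) := by
        refine ⟨by simp, fun j hj => ?_, fun a u j h => ?_⟩
        · obtain ⟨h₁, -, h₂⟩ := hT [] j (Finset.mem_of_mem_erase hj)
          exact ⟨h₁, fun l hl hl' => Finset.mem_erase.2 ⟨by simp, h₂ l hl hl'⟩⟩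
        · obtain ⟨h₁, h₂, h₃⟩ := hT (a :: u) j (Finset.mem_of_mem_erase h)
          exact ⟨h₁, Finset.mem_erase.2 ⟨by simp, h₂⟩,
            fun l hl hl' => Finset.mem_erase.2 ⟨by simp, h₃ l hl hl'⟩⟩
      obtain ⟨c, hc⟩ := this.exists_forestWords
      refine ⟨c, Subtype.ext ?_⟩
      simp only [treeWords, List.toFinset_cons, ← hc]
      exact Finset.insert_erase hT₀

theorem planarTreeEquiv_val (c : BinaryTree Unit) :
    (planarTreeEquiv c).val = (treeWords c).toFinset := rfl

theorem card_planarTreeEquiv (c : BinaryTree Unit) :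
    (planarTreeEquiv c).val.card = c.numNodes + 1 := by
  rw [planarTreeEquiv_val, List.toFinset_card_of_nodup (pairwise_treeWords c).nodup, treeWords,
    List.length_cons, ← length_forestDepths, ← List.length_map (f := List.length),
    map_length_forestWords, List.length_map]

theorem sort_planarTreeEquiv (c : BinaryTree Unit) :
    (planarTreeEquiv c).val.sort (· ≤ ·) = treeWords c := by
  rw [planarTreeEquiv_val]
  exact (List.toFinset_sort (· ≤ ·) (pairwise_treeWords c).nodup).2
    ((pairwise_treeWords c).imp le_of_lt)

theorem length_vertexAt_planarTreeEquiv (c : BinaryTree Unit) (m : ℕ) :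
    (vertexAt (planarTreeEquiv c) m).length =
      ((0 :: (forestDepths c).map Nat.succ)[m]?).getD 0 := by
  rw [vertexAt, sort_planarTreeEquiv, ← map_length_forestWords c 1, ← List.length_nil,
    ← List.map_cons, ← treeWords, List.getElem?_map, List.getD_eq_getElem?_getD]
  cases (treeWords c)[m]? <;> rfl

theorem numChildren_cons {S C : Finset (List ℕ)} {i : ℕ} {v : List ℕ}
    (h : ∀ j, i :: (v ++ [j]) ∈ S ↔ v ++ [j] ∈ C) : numChildren S (i :: v) = numChildren C v := by
  rw [numChildren, numChildren,
    ← Finset.card_image_of_injective (C.filter _) (List.cons_injective (a := i))]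
  congr 1
  ext w
  simp only [Finset.mem_filter, Finset.mem_image]
  constructor
  · rintro ⟨hw, j, rfl⟩
    exact ⟨v ++ [j], ⟨(h j).1 hw, j, rfl⟩, rfl⟩
  · rintro ⟨w, ⟨hw, j, rfl⟩, rfl⟩
    exact ⟨(h j).2 hw, j, rfl⟩

theorem numChildren_congr {S C : Finset (List ℕ)} {v : List ℕ}
    (h : ∀ j, v ++ [j] ∈ S ↔ v ++ [j] ∈ C) : numChildren S v = numChildren C v := by
  rw [numChildren, numChildren]
  congr 1
  ext w
  simp only [Finset.mem_filter]
  constructor <;> rintro ⟨hw, j, rfl⟩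
  exacts [⟨(h j).1 hw, j, rfl⟩, ⟨(h j).2 hw, j, rfl⟩]

theorem numChildren_forestWords_nil (f : BinaryTree Unit) (i : ℕ) :
    numChildren (forestWords f i).toFinset [] = rootCount f := by
  induction f generalizing i with
  | nil => simp [numChildren, forestWords, rootCount]
  | node _ c r hc hr =>
    have hi : [i] ∉ (forestWords r (i + 1)).toFinset := by
      rw [List.mem_toFinset]
      intro h
      obtain ⟨a, t, h, h'⟩ := exists_cons_of_mem_forestWords h
      simp only [List.cons.injEq] at h
      omega
    rw [rootCount, ← hr (i + 1), numChildren, numChildren,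
      ← Finset.card_insert_of_notMem (a := [i])]
    · congr 1
      ext w
      simp only [Finset.mem_filter, Finset.mem_insert, List.mem_toFinset, List.nil_append]
      constructor
      · rintro ⟨hw, j, rfl⟩
        rcases eq_or_ne j i with rfl | hj
        · exact Or.inl rfl
        · exact Or.inr ⟨(cons_mem_forestWords_node_of_ne hj).1 hw, j, rfl⟩
      · rintro (h | ⟨hw, j, rfl⟩)
        · subst h
          exact ⟨by simp [forestWords], i, rfl⟩
        · exact ⟨by simp [forestWords, hw], j, rfl⟩
    · simp [hi]

theorem prod_forestWords (μ : ℕ → ℝ) (f : BinaryTree Unit) (i : ℕ) :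
    ((forestWords f i).map fun u => μ (numChildren (forestWords f i).toFinset u)).prod =
      forestWeight μ f := by
  induction f generalizing i with
  | nil => rfl
  | node _ c r hc hr =>
    have h (v : List ℕ) : numChildren (forestWords (.node () c r) i).toFinset (i :: v) =
        numChildren (forestWords c 1).toFinset v :=
      numChildren_cons fun j => by simp [cons_mem_forestWords_node]
    have h₀ := (h []).trans (numChildren_forestWords_nil c 1)
    have h' : ∀ v ∈ forestWords r (i + 1),
        μ (numChildren (forestWords (.node () c r) i).toFinset v) =
        μ (numChildren (forestWords r (i + 1)).toFinset v) := fun v hv => by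
      obtain ⟨a, t, rfl, ha⟩ := exists_cons_of_mem_forestWords hv
      congr 1
      refine numChildren_congr fun j => ?_
      simp only [List.mem_toFinset]
      exact cons_mem_forestWords_node_of_ne (by omega)
    conv_lhs => enter [1, 2]; rw [forestWords]
    rw [List.map_cons, List.prod_cons, List.map_append, List.prod_append, List.map_map,
      List.map_congr_left h', hr, h₀, forestWeight, ← hc 1, mul_assoc]
    simp only [Function.comp_def, h]

theorem gwWeight_planarTreeEquiv (μ : ℕ → ℝ) (c : BinaryTree Unit) :
    gwWeight μ (planarTreeEquiv c).val = μ (rootCount c) * forestWeight μ c := by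
  rw [gwWeight, planarTreeEquiv_val, List.prod_toFinset _ (pairwise_treeWords c).nodup]
  have h (v : List ℕ) : numChildren (treeWords c).toFinset v =
      numChildren (forestWords c 1).toFinset v :=
    numChildren_congr fun j => by simp [treeWords]
  simp only [h]
  rw [treeWords, List.map_cons, List.prod_cons, prod_forestWords, numChildren_forestWords_nil]

theorem gwProb_inter_card (μ : ℕ → ℝ) (S : Set PlanarTree) (n : ℕ) :
    gwProb μ (S ∩ {T | T.val.card = n + 1}) =
      ∑ c ∈ BinaryTree.treesOfNumNodesEq n,
        if planarTreeEquiv c ∈ S then μ (rootCount c) * forestWeight μ c else 0 := by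
  rw [gwProb, tsum_subtype _ fun T : PlanarTree => gwWeight μ T.val, ← planarTreeEquiv.tsum_eq,
    tsum_eq_sum (s := BinaryTree.treesOfNumNodesEq n)]
  · refine Finset.sum_congr rfl fun c hc => ?_
    rw [BinaryTree.mem_treesOfNumNodesEq] at hc
    simp [Set.indicator_apply, card_planarTreeEquiv, hc, gwWeight_planarTreeEquiv]
  · intro c hc
    rw [BinaryTree.mem_treesOfNumNodesEq] at hc
    simp [card_planarTreeEquiv, hc]

theorem treeSizeProb_succ (μ : ℕ → ℝ) (n : ℕ) :
    treeSizeProb μ (n + 1) =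
      ∑ c ∈ BinaryTree.treesOfNumNodesEq n, μ (rootCount c) * forestWeight μ c := by
  rw [treeSizeProb, ← Set.univ_inter {T : PlanarTree | T.val.card = n + 1}, gwProb_inter_card]
  simp

theorem treeSizeProb_zero (μ : ℕ → ℝ) : treeSizeProb μ 0 = 0 := by
  have : {T : PlanarTree | T.val.card = 0} = ∅ := by
    ext T
    simpa using Finset.ne_empty_of_mem T.2.1
  rw [treeSizeProb, this, gwProb]
  simp

section GeneratingFunction

open PowerSeries

variable {A : Type*} [CommRing A]

/-- The generating function of a function on forests, the variable counting the vertices. -/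
def forestGF (φ : BinaryTree Unit → A) : A⟦X⟧ :=
  PowerSeries.mk fun n => ∑ f ∈ BinaryTree.treesOfNumNodesEq n, φ f

theorem coeff_forestGF (φ : BinaryTree Unit → A) (n : ℕ) :
    coeff n (forestGF φ) = ∑ f ∈ BinaryTree.treesOfNumNodesEq n, φ f :=
  coeff_mk _ _

theorem coeff_forestGF_zero (φ : BinaryTree Unit → A) : coeff 0 (forestGF φ) = φ .nil := by
  simp [coeff_forestGF]

theorem coeff_forestGF_succ (φ : BinaryTree Unit → A) (n : ℕ) :
    coeff (n + 1) (forestGF φ) = ∑ p ∈ Finset.HasAntidiagonal.antidiagonal n,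
      ∑ c ∈ BinaryTree.treesOfNumNodesEq p.1, ∑ r ∈ BinaryTree.treesOfNumNodesEq p.2,
        φ (.node () c r) := by
  rw [coeff_forestGF, BinaryTree.treesOfNumNodesEq_succ, Finset.sum_biUnion]
  · refine Finset.sum_congr rfl fun p _ => ?_
    rw [Finset.sum_map, Finset.sum_product]
    rfl
  · intro p _ q _ hpq
    refine Finset.disjoint_left.2 fun f hp hq => hpq ?_
    obtain ⟨⟨c, r⟩, hcr, rfl⟩ := Finset.mem_map.1 hp
    obtain ⟨⟨c', r'⟩, hcr', h⟩ := Finset.mem_map.1 hq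
    simp only [Finset.mem_product, BinaryTree.mem_treesOfNumNodesEq] at hcr hcr'
    obtain ⟨-, rfl, rfl⟩ := BinaryTree.node.inj h
    exact Prod.ext (hcr.1.symm.trans hcr'.1) (hcr.2.symm.trans hcr'.2)

theorem forestGF_eq_mul_add_mul {φ α β α' β' : BinaryTree Unit → A} (h₀ : φ .nil = 0)
    (h : ∀ c r, φ (.node () c r) = α c * β r + α' c * β' r) :
    forestGF φ = X * forestGF α * forestGF β + X * forestGF α' * forestGF β' := by
  ext n
  rw [mul_assoc, mul_assoc, ← mul_add]
  cases n with
  | zero => rw [coeff_forestGF_zero, h₀, coeff_zero_X_mul]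
  | succ n =>
    rw [coeff_succ_X_mul]
    simp only [map_add, coeff_mul, coeff_forestGF_succ, coeff_forestGF, h,
      Finset.sum_add_distrib, Finset.sum_mul_sum]

theorem forestGF_eq_mul {φ α β : BinaryTree Unit → A} (h₀ : φ .nil = 0)
    (h : ∀ c r, φ (.node () c r) = α c * β r) :
    forestGF φ = X * forestGF α * forestGF β := by
  have := forestGF_eq_mul_add_mul (α := α) (β := β) (α' := 0) (β' := 0) h₀ (by simpa using h)
  rw [this]
  have : forestGF (0 : BinaryTree Unit → A) = 0 := by
    ext n
    simp [coeff_forestGF]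
  simp [this]

theorem rescale_forestGF (a : A) (φ : BinaryTree Unit → A) :
    rescale a (forestGF φ) = forestGF fun f => a ^ f.numNodes * φ f := by
  ext n
  rw [coeff_rescale, coeff_forestGF, coeff_forestGF, Finset.mul_sum]
  refine Finset.sum_congr rfl fun f hf => ?_
  rw [BinaryTree.mem_treesOfNumNodesEq.1 hf]

theorem C_mul_forestGF (a : A) (φ : BinaryTree Unit → A) :
    C a * forestGF φ = forestGF fun f => a * φ f := by
  ext n
  rw [coeff_C_mul, coeff_forestGF, coeff_forestGF, Finset.mul_sum]

theorem sum_forestGF {ι : Type*} (s : Finset ι) (φ : ι → BinaryTree Unit → A) :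
    ∑ i ∈ s, forestGF (φ i) = forestGF fun f => ∑ i ∈ s, φ i f := by
  ext n
  simp only [map_sum, coeff_forestGF]
  exact Finset.sum_comm

theorem map_forestGF {B : Type*} [CommRing B] (g : A →+* B) (φ : BinaryTree Unit → A) :
    PowerSeries.map g (forestGF φ) = forestGF fun f => g (φ f) := by
  ext n
  simp [coeff_forestGF]

/-- The generating function of the total size of a Galton–Watson tree. -/
def treeSizeGF (μ : ℕ → ℝ) : ℝ⟦X⟧ := PowerSeries.mk (treeSizeProb μ)

theorem treeSizeGF_eq (μ : ℕ → ℝ) :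
    treeSizeGF μ = X * forestGF fun c => μ (rootCount c) * forestWeight μ c := by
  ext n
  rw [treeSizeGF, coeff_mk]
  cases n with
  | zero => rw [treeSizeProb_zero, coeff_zero_X_mul]
  | succ n => rw [treeSizeProb_succ, coeff_succ_X_mul, coeff_forestGF]

theorem forestSizeProb_eq_coeff (μ : ℕ → ℝ) (k n : ℕ) :
    forestSizeProb μ k n = coeff n (treeSizeGF μ ^ k) := by
  induction k generalizing n with
  | zero => simp [forestSizeProb, coeff_one]
  | succ k ih =>
    rw [forestSizeProb, pow_succ', coeff_mul,
      Finset.Nat.sum_antidiagonal_eq_sum_range_succ_mk]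
    simp [ih, treeSizeGF]

theorem forestGF_rootCount_eq (μ : ℕ → ℝ) (k : ℕ) :
    (forestGF fun f => if rootCount f = k then forestWeight μ f else 0) = treeSizeGF μ ^ k := by
  induction k with
  | zero =>
    ext n
    rw [pow_zero, coeff_one]
    cases n with
    | zero => simp [coeff_forestGF_zero, rootCount, forestWeight]
    | succ n => simp [coeff_forestGF_succ, rootCount]
  | succ k ih =>
    rw [pow_succ', ← ih, treeSizeGF_eq]
    refine forestGF_eq_mul (by simp [rootCount]) fun c r => ?_
    simp only [rootCount, forestWeight, Nat.add_right_cancel_iff]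
    split_ifs <;> simp

end GeneratingFunction

section DepthPolynomial

open Polynomial

/-- The polynomial `∑ X ^ m`, where `m` runs over the positions of the entry `h` in a list. -/
def positionPoly (h : ℕ) : List ℕ → ℝ[X]
  | [] => 0
  | a :: l => (if a = h then 1 else 0) + X * positionPoly h l

theorem positionPoly_append (h : ℕ) (l l' : List ℕ) :
    positionPoly h (l ++ l') = positionPoly h l + X ^ l.length * positionPoly h l' := by
  induction l with
  | nil => simp [positionPoly]
  | cons a l ih =>
    simp only [List.cons_append, positionPoly, ih, List.length_cons]
    ring

theorem positionPoly_zero_map_succ (l : List ℕ) : positionPoly 0 (l.map Nat.succ) = 0 := by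
  induction l with
  | nil => rfl
  | cons a l ih => simp [positionPoly, ih]

theorem positionPoly_succ_map_succ (h : ℕ) (l : List ℕ) :
    positionPoly (h + 1) (l.map Nat.succ) = positionPoly h l := by
  induction l with
  | nil => rfl
  | cons a l ih => simp [positionPoly, ih]

theorem coeff_positionPoly (h : ℕ) (l : List ℕ) (m : ℕ) :
    (positionPoly h l).coeff m = if l[m]? = some h then 1 else 0 := by
  induction l generalizing m with
  | nil => simp [positionPoly]
  | cons a l ih =>
    cases m with
    | zero =>
      by_cases ha : a = h <;> simp [positionPoly, ha]
    | succ m =>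
      by_cases ha : a = h <;> simp [positionPoly, ha, ih, coeff_one]

/-- The depths, in depth-first order, of the vertices of the tree whose non-root vertices form
the forest `c`. -/
def treeDepths (c : BinaryTree Unit) : List ℕ := 0 :: (forestDepths c).map Nat.succ

theorem positionPoly_zero_treeDepths (c : BinaryTree Unit) :
    positionPoly 0 (treeDepths c) = 1 := by
  simp [treeDepths, positionPoly, positionPoly_zero_map_succ]

theorem positionPoly_succ_treeDepths (h : ℕ) (c : BinaryTree Unit) :
    positionPoly (h + 1) (treeDepths c) = X * positionPoly h (forestDepths c) := by
  simp [treeDepths, positionPoly, positionPoly_succ_map_succ]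

theorem positionPoly_forestDepths_node (h : ℕ) (c r : BinaryTree Unit) :
    positionPoly h (forestDepths (.node () c r)) =
      positionPoly h (treeDepths c) +
        X ^ (c.numNodes + 1) * positionPoly h (forestDepths r) := by
  rw [forestDepths, ← List.cons_append, ← treeDepths, positionPoly_append]
  simp [treeDepths, length_forestDepths]

end DepthPolynomial

section Spine

open PowerSeries

/-- The generating function of Galton–Watson trees with a marked vertex at depth `h`; the power
series variable counts all vertices, the polynomial variable those preceding the marked one. -/
def markedTreeGF (μ : ℕ → ℝ) (h : ℕ) : (Polynomial ℝ)⟦X⟧ :=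
  X * forestGF fun c =>
    Polynomial.C (μ (rootCount c) * forestWeight μ c) * positionPoly h (treeDepths c)

/-- The generating function of forests with `k` roots and a marked vertex at depth `h`. -/
def markedForestGF (μ : ℕ → ℝ) (h k : ℕ) : (Polynomial ℝ)⟦X⟧ :=
  forestGF fun f =>
    if rootCount f = k then Polynomial.C (forestWeight μ f) * positionPoly h (forestDepths f) else 0

/-- The generating function of the total size, counted by the power series variable. -/
def totalGF (μ : ℕ → ℝ) : (Polynomial ℝ)⟦X⟧ := PowerSeries.map Polynomial.C (treeSizeGF μ)

/-- The generating function of the total size, counted by both variables. -/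
def precedingGF (μ : ℕ → ℝ) : (Polynomial ℝ)⟦X⟧ := rescale Polynomial.X (totalGF μ)

theorem totalGF_eq (μ : ℕ → ℝ) :
    totalGF μ = X * forestGF fun c => Polynomial.C (μ (rootCount c) * forestWeight μ c) := by
  rw [totalGF, treeSizeGF_eq, map_mul, map_X, map_forestGF]

theorem precedingGF_eq (μ : ℕ → ℝ) :
    precedingGF μ = X * forestGF fun c =>
      Polynomial.X ^ (c.numNodes + 1) * Polynomial.C (μ (rootCount c) * forestWeight μ c) := by
  rw [precedingGF, totalGF_eq, map_mul, rescale_X, rescale_forestGF, mul_comm (C _), mul_assoc,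
    C_mul_forestGF]
  simp only [pow_succ', mul_assoc]

theorem markedTreeGF_zero (μ : ℕ → ℝ) : markedTreeGF μ 0 = totalGF μ := by
  simp [markedTreeGF, totalGF_eq, positionPoly_zero_treeDepths]

theorem markedForestGF_zero (μ : ℕ → ℝ) (h : ℕ) : markedForestGF μ h 0 = 0 := by
  ext1 n
  rw [markedForestGF, coeff_forestGF, map_zero]
  refine Finset.sum_eq_zero fun f _ => ?_
  cases f <;> simp [rootCount, forestDepths, positionPoly]

theorem markedForestGF_succ (μ : ℕ → ℝ) (h k : ℕ) :
    markedForestGF μ h (k + 1) =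
      markedTreeGF μ h * totalGF μ ^ k + precedingGF μ * markedForestGF μ h k := by
  rw [markedTreeGF, precedingGF_eq, markedForestGF, markedForestGF, totalGF, ← map_pow,
    ← forestGF_rootCount_eq, map_forestGF]
  refine forestGF_eq_mul_add_mul (by simp [rootCount]) fun c r => ?_
  simp only [rootCount, forestWeight, Nat.add_right_cancel_iff, positionPoly_forestDepths_node]
  split_ifs
  · simp only [map_mul]
    ring
  · simp

theorem markedForestGF_eq (μ : ℕ → ℝ) (h k : ℕ) :
    markedForestGF μ h k = markedTreeGF μ h *
      ∑ j ∈ Finset.range k, totalGF μ ^ j * precedingGF μ ^ (k - 1 - j) := by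
  induction k with
  | zero => simp [markedForestGF_zero]
  | succ k ih =>
    rw [markedForestGF_succ, ih, Nat.add_sub_cancel, geom_sum₂_succ_eq]
    ring

theorem markedTreeGF_succ {μ : ℕ → ℝ} {K : ℕ} (hK : ∀ k, K < k → μ k = 0) (h : ℕ) :
    markedTreeGF μ (h + 1) = C Polynomial.X * X *
      ∑ k ∈ Finset.range (K + 1), C (Polynomial.C (μ k)) * markedForestGF μ h k := by
  simp only [markedForestGF, C_mul_forestGF, sum_forestGF]
  rw [markedTreeGF, mul_comm (C _), mul_assoc, C_mul_forestGF]
  congr 2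
  ext1 c
  rw [positionPoly_succ_treeDepths]
  simp only [mul_ite, mul_zero]
  rw [Finset.sum_ite_eq]
  split_ifs with hc
  · simp only [map_mul]
    ring
  · rw [hK _ (by simpa using hc)]
    simp

theorem sum_range_sum_range_eq_sum_IK {M : Type*} [AddCommMonoid M] (K : ℕ) (g : ℕ → ℕ → ℕ → M) :
    ∑ k ∈ Finset.range (K + 1), ∑ j ∈ Finset.range k, g k j (k - 1 - j) =
      ∑ i : IK K, g i.val.1 (i.val.1 - i.val.2) (i.val.2 - 1) := by
  rw [Finset.sum_sigma']
  refine Finset.sum_bij' (fun p hp => (⟨(p.1, p.1 - p.2), ?_⟩ : IK K))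
    (fun i _ => ⟨i.val.1, i.val.1 - i.val.2⟩) ?_ ?_ ?_ ?_ ?_
  · simp only [Finset.mem_sigma, Finset.mem_range] at hp
    simp only [IKfin, Finset.mem_filter, Finset.mem_product, Finset.mem_range]
    omega
  · exact fun _ _ => Finset.mem_univ _
  · rintro ⟨⟨k, j⟩, h⟩ _
    simp only [IKfin, Finset.mem_filter, Finset.mem_product, Finset.mem_range] at h
    simp only [Finset.mem_sigma, Finset.mem_range]
    omega
  · rintro ⟨k, j⟩ h
    simp only [Finset.mem_sigma, Finset.mem_range] at h
    simp only [Sigma.mk.injEq, heq_eq_eq, true_and]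
    omega
  · rintro ⟨⟨k, j⟩, h⟩ _
    simp only [IKfin, Finset.mem_filter, Finset.mem_product, Finset.mem_range] at h
    refine Subtype.ext (Prod.ext rfl ?_)
    change k - (k - j) = j
    omega
  · rintro ⟨k, j⟩ h
    simp only [Finset.mem_sigma, Finset.mem_range] at h
    simp only
    congr 1 <;> omega

theorem markedTreeGF_eq {μ : ℕ → ℝ} {K : ℕ} (hK : ∀ k, K < k → μ k = 0) (h : ℕ) :
    markedTreeGF μ h = (C Polynomial.X * X) ^ h *
      (∑ i : IK K, C (Polynomial.C (μ i.val.1)) *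
        (totalGF μ ^ (i.val.1 - i.val.2) * precedingGF μ ^ (i.val.2 - 1))) ^ h * totalGF μ := by
  induction h with
  | zero => simp [markedTreeGF_zero]
  | succ h ih =>
    have hs : ∑ k ∈ Finset.range (K + 1), C (Polynomial.C (μ k)) * markedForestGF μ h k =
        markedTreeGF μ h * ∑ i : IK K, C (Polynomial.C (μ i.val.1)) *
          (totalGF μ ^ (i.val.1 - i.val.2) * precedingGF μ ^ (i.val.2 - 1)) := by
      rw [← sum_range_sum_range_eq_sum_IK K fun k a b =>
        C (Polynomial.C (μ k)) * (totalGF μ ^ a * precedingGF μ ^ b), Finset.mul_sum]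
      refine Finset.sum_congr rfl fun k _ => ?_
      rw [markedForestGF_eq, ← Finset.mul_sum, mul_left_comm]
    rw [markedTreeGF_succ hK, hs, ih]
    ring

theorem markedTreeGF_eq_sum {μ : ℕ → ℝ} {K : ℕ} (hK : ∀ k, K < k → μ k = 0) (h : ℕ) :
    markedTreeGF μ h = ∑ a ∈ Finset.piAntidiag (Finset.univ : Finset (IK K)) h,
      C (Polynomial.C (Qmult μ K h a)) * ((C Polynomial.X * X) ^ h *
        (precedingGF μ ^ N1 a * totalGF μ ^ (1 + N2 a))) := by
  rw [markedTreeGF_eq hK, Finset.sum_pow_eq_sum_piAntidiag, Finset.mul_sum, Finset.sum_mul]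
  refine Finset.sum_congr rfl fun a ha => ?_
  have ha : ∑ i, a i = h := (Finset.mem_piAntidiag.1 ha).1
  have hm : (Nat.multinomial Finset.univ a : ℝ) =
      (h.factorial : ℝ) / ∏ i, ((a i).factorial : ℝ) := by
    rw [eq_div_iff (Finset.prod_ne_zero_iff.2 fun i _ => by positivity), mul_comm, ← ha]
    exact_mod_cast Nat.multinomial_spec Finset.univ a
  have hQ : C (Polynomial.C (Qmult μ K h a)) = (Nat.multinomial Finset.univ a : (Polynomial ℝ)⟦X⟧) *
      ∏ i, C (Polynomial.C (μ i.val.1)) ^ a i := by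
    rw [Qmult, if_pos ha, ← hm]
    simp only [map_mul, map_prod, map_pow, map_natCast]
  have h₁ : ∏ i, (precedingGF μ ^ (i.val.2 - 1)) ^ a i = precedingGF μ ^ N1 a := by
    simp only [← pow_mul, N1, Finset.prod_pow_eq_pow_sum]
  have h₂ : ∏ i, (totalGF μ ^ (i.val.1 - i.val.2)) ^ a i = totalGF μ ^ N2 a := by
    simp only [← pow_mul, N2, Finset.prod_pow_eq_pow_sum]
  simp only [mul_pow, Finset.prod_mul_distrib, h₁, h₂, hQ, pow_add]
  ring

theorem coeff_coeff_precedingGF_mul_totalGF (μ : ℕ → ℝ) (h a b : ℕ) {m N : ℕ} (hm : m ≤ N) :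
    (coeff N ((C Polynomial.X * X) ^ h * (precedingGF μ ^ a * totalGF μ ^ b))).coeff m =
      forestSizeProbZ μ a ((m : ℤ) - h) * forestSizeProbZ μ b ((N : ℤ) - m) := by
  rw [mul_pow, ← map_pow, mul_assoc, coeff_C_mul, coeff_X_pow_mul', Polynomial.coeff_X_pow_mul',
    forestSizeProbZ, forestSizeProbZ]
  by_cases hh : h ≤ m
  · have e₁ : ((m : ℤ) - h).toNat = m - h := by omega
    have e₂ : ((N : ℤ) - m).toNat = N - m := by omega
    rw [if_pos hh, if_pos (hh.trans hm), if_pos (by omega), if_pos (by omega), e₁, e₂,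
      forestSizeProb_eq_coeff, forestSizeProb_eq_coeff, precedingGF, totalGF, ← map_pow,
      ← map_pow, ← map_pow, coeff_mul, Polynomial.finsetSum_coeff,
      Finset.sum_eq_single (m - h, N - m)]
    · simp [-map_pow, coeff_rescale, mul_assoc]
    · rintro ⟨i, j⟩ hij hne
      have : m - h ≠ i := by
        rintro rfl
        rw [Finset.HasAntidiagonal.mem_antidiagonal] at hij
        exact hne (Prod.ext rfl (show j = N - m by omega))
      simp only [coeff_rescale, coeff_map]
      rw [mul_assoc, ← map_mul, Polynomial.coeff_X_pow_mul', Polynomial.coeff_C]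
      split_ifs <;> first | rfl | omega
    · intro hne
      have : m - h + (N - m) = N - h := by omega
      exact absurd (Finset.HasAntidiagonal.mem_antidiagonal.2 this) hne
  · rw [if_neg hh, if_neg (by omega), zero_mul]

theorem gwProb_length_vertexAt (μ : ℕ → ℝ) {n m : ℕ} (hm : m ≤ n) (h : ℕ) :
    gwProb μ ({T | (vertexAt T m).length = h} ∩ {T | T.val.card = n + 1}) =
      (coeff (n + 1) (markedTreeGF μ h)).coeff m := by
  rw [gwProb_inter_card, markedTreeGF, coeff_succ_X_mul, coeff_forestGF,
    Polynomial.finsetSum_coeff]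
  refine Finset.sum_congr rfl fun c hc => ?_
  have hlt : m < (treeDepths c).length := by
    simp [treeDepths, length_forestDepths, BinaryTree.mem_treesOfNumNodesEq.1 hc]
    omega
  rw [Polynomial.coeff_C_mul, coeff_positionPoly, Set.mem_ofPred_eq,
    length_vertexAt_planarTreeEquiv, ← treeDepths, List.getElem?_eq_getElem hlt]
  simp

end Spine

/-- Assume (H1).  For every `h ≥ 0` and `m ∈ {0,…,n}`,
`P_n(|u(m)| = h) = P(|f_{N₁(ℳ^{(h)})}| = m-h, |f'_{1+N₂(ℳ^{(h)})}| = n+1-m) / P(|𝐓| = n+1)`,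
where `ℳ^{(h)}` is multinomial with parameters `h` and `p`, independent of the two
independent Galton-Watson forests `f, f'` (so the numerator is the `Q_h`-average of
the product of the two forest-size probabilities). -/
theorem statement13
    (μ : ℕ → ℝ) (K : ℕ) (hμ : H1 μ K) (n m h : ℕ) (hm : m ≤ n) :
    condProb μ n {T | (vertexAt T m).length = h} =
      (∑' a : IK K → ℕ,
        Qmult μ K h a *
          (forestSizeProbZ μ (N1 a) ((m : ℤ) - (h : ℤ)) *
            forestSizeProbZ μ (1 + N2 a) ((n : ℤ) + 1 - (m : ℤ)))) /
        treeSizeProb μ (n + 1) := by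
  rw [condProb, gwProb_length_vertexAt μ hm, markedTreeGF_eq_sum hμ.2.2.2.2.2, map_sum,
    Polynomial.finsetSum_coeff, tsum_eq_sum (s := Finset.piAntidiag Finset.univ h)]
  · refine congrArg (· / treeSizeProb μ (n + 1)) ?_
    refine Finset.sum_congr rfl fun a _ => ?_
    rw [PowerSeries.coeff_C_mul, Polynomial.coeff_C_mul,
      coeff_coeff_precedingGF_mul_totalGF μ h _ _ (by omega)]
    push_cast
    rfl
  · intro a ha
    rw [Qmult, if_neg, zero_mul]
    simpa using ha

end
end
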